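/- Let Λ be an almost n-minimal Auslander-Gorenstein algebra with n ≥ 1, i.e., an Artin algebra such that, for the injective module I with add I = {finitely generated injective Λ-modules of projective dimension at most 1}, one has id Λ ≤ n+1 ≤ I-domdim Λ. Then every finitely generated Gorenstein projective Λ-module X (equivalently, since Λ is Gorenstein, every X with Ext^i_Λ(X,Λ) = 0 for all i ≥ 1) satisfies I-domdim X ≥ n+1. -/

import Mathlib

open CategoryTheory

universe u

noncomputable instance hasExtModuleCat (A : Type u) [Ring A] : HasExt.{u+1} (ModuleCat.{u} A) :=
  letI := HasDerivedCategory.standard (ModuleCat.{u} A)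
  hasExt_of_hasDerivedCategory _

/-- `Ext^i_A(X, Y) = 0`. -/
def ExtVanishes (A : Type u) [Ring A] (X Y : Type u) [AddCommGroup X] [Module A X]
    [AddCommGroup Y] [Module A Y] (i : ℕ) : Prop :=
  Subsingleton (Abelian.Ext (ModuleCat.of A X) (ModuleCat.of A Y) i)

/-- `X ∈ add M`: `X` is a direct summand of a finite direct sum of copies of `M`. -/
def InAdd (Λ : Type u) [Ring Λ] (M : Type u) [AddCommGroup M] [Module Λ M]
    (X : Type u) [AddCommGroup X] [Module Λ X] : Prop :=
  ∃ (k : ℕ) (ι : X →ₗ[Λ] (Fin k → M)) (π : (Fin k → M) →ₗ[Λ] X), π ∘ₗ ι = LinearMap.id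

/-- `I`-domdim of `Y` is at least `t`: there is an exact sequence
`0 → Y → J_0 → ⋯ → J_{t-1}` with all `J_i ∈ add I`. -/
def IDomdimGE (Λ : Type u) [Ring Λ] (I : Type u) [AddCommGroup I] [Module Λ I]
    (Y : Type u) [AddCommGroup Y] [Module Λ Y] (t : ℕ) : Prop :=
  ∃ (J : ℕ → ModuleCat.{u} Λ) (g : Y →ₗ[Λ] J 0) (f : ∀ i, (J i : Type u) →ₗ[Λ] J (i+1)),
    (∀ i < t, InAdd Λ I (J i)) ∧
    (1 ≤ t → Function.Injective g) ∧
    (2 ≤ t → Function.Exact g (f 0)) ∧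
    (∀ i, i + 3 ≤ t → Function.Exact (f i) (f (i+1)))

/-- The projective dimension of `N` is at most `m`: there is a projective resolution
`0 → P_m → ⋯ → P_0 → N → 0`. -/
def ProjDimLE (Λ : Type u) [Ring Λ] (N : Type u) [AddCommGroup N] [Module Λ N] (m : ℕ) : Prop :=
  ∃ (P : ℕ → ModuleCat.{u} Λ) (f : ∀ i, (P (i+1) : Type u) →ₗ[Λ] P i) (g : (P 0 : Type u) →ₗ[Λ] N),
    (∀ i, Module.Projective Λ (P i)) ∧
    (∀ i, m < i → Subsingleton (P i)) ∧
    Function.Surjective g ∧ Function.Exact (f 0) g ∧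
    (∀ i, Function.Exact (f (i+1)) (f i))

/-- The injective dimension of `N` is at most `m`: there is an injective coresolution
`0 → N → J_0 → ⋯ → J_m → 0`. -/
def InjDimLE (Λ : Type u) [Ring Λ] (N : Type u) [AddCommGroup N] [Module Λ N] (m : ℕ) : Prop :=
  ∃ (J : ℕ → ModuleCat.{u} Λ) (g : N →ₗ[Λ] J 0) (f : ∀ i, (J i : Type u) →ₗ[Λ] J (i+1)),
    (∀ i, Module.Injective Λ (J i)) ∧
    (∀ i, m < i → Subsingleton (J i)) ∧
    Function.Injective g ∧ Function.Exact g (f 0) ∧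
    (∀ i, Function.Exact (f i) (f (i+1)))

/-- `M` is a cogenerator: every finitely generated module embeds into a finite
direct sum of copies of `M`. -/
def IsCogenerator (A : Type u) [Ring A] (M : Type u) [AddCommGroup M] [Module A M] : Prop :=
  ∀ (X : Type u) [AddCommGroup X] [Module A X], Module.Finite A X →
    ∃ (k : ℕ) (f : X →ₗ[A] (Fin k → M)), Function.Injective f

/-- `M`-codim `A ≤ m`: there is an exact sequence `0 → A → M_0 → ⋯ → M_m → 0` with all
`M_i ∈ add M` which stays exact after applying `Hom_A(-, M)`. -/
def MCodimLE (A : Type u) [Ring A] (M : Type u) [AddCommGroup M] [Module A M] (m : ℕ) : Prop :=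
  ∃ (C : ℕ → ModuleCat.{u} A) (g : A →ₗ[A] C 0) (f : ∀ i, (C i : Type u) →ₗ[A] C (i+1)),
    (∀ i ≤ m, InAdd A M (C i)) ∧
    (∀ i, m < i → Subsingleton (C i)) ∧
    Function.Injective g ∧ Function.Exact g (f 0) ∧
    (∀ i, Function.Exact (f i) (f (i+1))) ∧
    Function.Surjective (fun φ : (C 0 : Type u) →ₗ[A] M => φ ∘ₗ g) ∧
    Function.Exact (fun φ : (C 1 : Type u) →ₗ[A] M => φ ∘ₗ (f 0))
      (fun φ : (C 0 : Type u) →ₗ[A] M => φ ∘ₗ g) ∧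
    (∀ i, Function.Exact (fun φ : (C (i+2) : Type u) →ₗ[A] M => φ ∘ₗ (f (i+1)))
      (fun φ : (C (i+1) : Type u) →ₗ[A] M => φ ∘ₗ (f i)))

/-- The canonical ring homomorphism from `Λ` to the endomorphism ring of `I` over
`End_Λ(I)`, sending `λ` to multiplication by `λ`. -/
@[simps] def evalRingHom (Λ : Type u) [Ring Λ] (I : Type u) [AddCommGroup I] [Module Λ I] :
    Λ →+* Module.End (Module.End Λ I) I where
  toFun a :=
    { toFun := fun x => a • x
      map_add' := fun x y => smul_add a x y
      map_smul' := fun φ x => (φ.map_smul a x).symm }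
  map_one' := by ext x; simp
  map_mul' a b := by ext x; simp [mul_smul]
  map_zero' := by ext x; simp
  map_add' a b := by ext x; simp [add_smul]

section ShortExact

variable {Λ : Type u} [Ring Λ]

/-- `0 → A → B → C → 0` is a short exact sequence. -/
structure IsSES {A B C : Type u} [AddCommGroup A] [Module Λ A] [AddCommGroup B] [Module Λ B]
    [AddCommGroup C] [Module Λ C] (f : A →ₗ[Λ] B) (g : B →ₗ[Λ] C) : Prop where
  inj : Function.Injective f
  exact : Function.Exact f g
  surj : Function.Surjective g

variable {A B C D E F : Type u} [AddCommGroup A] [Module Λ A] [AddCommGroup B] [Module Λ B]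
  [AddCommGroup C] [Module Λ C] [AddCommGroup D] [Module Λ D] [AddCommGroup E] [Module Λ E]
  [AddCommGroup F] [Module Λ F]

namespace IsSES

/-- The short complex in `ModuleCat` attached to a short exact sequence. -/
abbrev complex {f : A →ₗ[Λ] B} {g : B →ₗ[Λ] C} (h : IsSES f g) :
    ShortComplex (ModuleCat.{u} Λ) :=
  ShortComplex.mk (ModuleCat.ofHom f) (ModuleCat.ofHom g)
    (by ext x; exact (h.exact _).2 ⟨x, rfl⟩)

lemma shortExact {f : A →ₗ[Λ] B} {g : B →ₗ[Λ] C} (h : IsSES f g) : h.complex.ShortExact where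
  exact := (ShortComplex.ShortExact.moduleCat_exact_iff_function_exact _).2 h.exact
  mono_f := (ModuleCat.mono_iff_injective _).2 h.inj
  epi_g := (ModuleCat.epi_iff_surjective _).2 h.surj

lemma ker {g : B →ₗ[Λ] C} (hg : Function.Surjective g) : IsSES (LinearMap.ker g).subtype g :=
  ⟨Subtype.val_injective, LinearMap.exact_subtype_ker_map g, hg⟩

lemma coker {f : A →ₗ[Λ] B} (hf : Function.Injective f) :
    IsSES f (LinearMap.range f).mkQ :=
  ⟨hf, LinearMap.exact_map_mkQ_range f, Submodule.mkQ_surjective _⟩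

lemma mkQ (N : Submodule Λ B) : IsSES N.subtype N.mkQ :=
  ⟨N.injective_subtype, LinearMap.exact_subtype_mkQ N, N.mkQ_surjective⟩

variable (Λ A B) in
lemma inl_snd : IsSES (LinearMap.inl Λ A B) (LinearMap.snd Λ A B) :=
  ⟨LinearMap.inl_injective, .inl_snd, LinearMap.snd_surjective⟩

lemma prodMap {f : A →ₗ[Λ] B} {g : B →ₗ[Λ] C} {f' : D →ₗ[Λ] E} {g' : E →ₗ[Λ] F}
    (h : IsSES f g) (h' : IsSES f' g') : IsSES (f.prodMap f') (g.prodMap g') where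
  inj := by
    rintro ⟨a, b⟩ ⟨a', b'⟩ e
    simp only [LinearMap.prodMap_apply, Prod.mk.injEq] at e
    rw [h.inj e.1, h'.inj e.2]
  exact := by
    rintro ⟨a, b⟩
    simp only [LinearMap.prodMap_apply, Prod.mk_eq_zero, h.exact a, h'.exact b, Set.mem_range,
      Prod.exists, Prod.mk.injEq]
    exact ⟨fun ⟨⟨x, hx⟩, ⟨y, hy⟩⟩ => ⟨x, y, hx, hy⟩, fun ⟨x, y, hx, hy⟩ => ⟨⟨x, hx⟩, ⟨y, hy⟩⟩⟩
  surj := by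
    rintro ⟨a, b⟩
    obtain ⟨x, rfl⟩ := h.surj a
    obtain ⟨y, rfl⟩ := h'.surj b
    exact ⟨(x, y), rfl⟩

lemma comp_equiv {f : A →ₗ[Λ] B} {g : B →ₗ[Λ] C} (h : IsSES f g) (e : C ≃ₗ[Λ] D) :
    IsSES f (e.toLinearMap ∘ₗ g) where
  inj := h.inj
  exact := by intro x; simp [h.exact x]
  surj := e.surjective.comp h.surj

lemma equiv_comp {f : A →ₗ[Λ] B} {g : B →ₗ[Λ] C} (h : IsSES f g) (e : D ≃ₗ[Λ] A) :
    IsSES (f ∘ₗ e.toLinearMap) g where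
  inj := h.inj.comp e.injective
  exact := by
    intro x
    rw [h.exact x]
    constructor
    · rintro ⟨y, rfl⟩; exact ⟨e.symm y, by simp⟩
    · rintro ⟨y, rfl⟩; exact ⟨e y, rfl⟩
  surj := h.surj

lemma equiv_prod {f : A →ₗ[Λ] B} {g : B →ₗ[Λ] C} (h : IsSES f g) [Module.Projective Λ C] :
    Nonempty (B ≃ₗ[Λ] A × C) := by
  obtain ⟨l, hl⟩ := Module.projective_lifting_property g LinearMap.id h.surj
  exact ⟨(h.exact.splitSurjectiveEquiv h.inj ⟨l, hl⟩).1⟩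

/-- The pullback of `f : A → C` and `q : P → C`, projected to `P` when `f` is surjective. -/
lemma pullback_snd {f : A →ₗ[Λ] C} {q : B →ₗ[Λ] C} {k : D →ₗ[Λ] A} (h : IsSES k f) :
    ∃ i : D →ₗ[Λ] LinearMap.ker (f.coprod (-q)),
      IsSES i (LinearMap.snd Λ A B ∘ₗ (LinearMap.ker (f.coprod (-q))).subtype) := by
  have hk : ∀ x, f (k x) = 0 := fun x => (h.exact _).2 ⟨x, rfl⟩
  refine ⟨(LinearMap.inl Λ A B ∘ₗ k).codRestrict _ (by simp [hk]), ?_, ?_, ?_⟩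
  · intro x y hxy
    apply h.inj
    exact congrArg (fun z => z.1.1) hxy
  · rintro ⟨⟨a, b⟩, hab⟩
    simp only [LinearMap.mem_ker, LinearMap.coprod_apply, LinearMap.neg_apply] at hab
    constructor
    · intro hb
      change b = 0 at hb
      subst hb
      obtain ⟨d, rfl⟩ := (h.exact a).1 (by simpa using hab)
      exact ⟨d, rfl⟩
    · rintro ⟨d, hd⟩
      exact (congrArg (fun z => z.1.2) hd).symm
  · intro b
    obtain ⟨a, ha⟩ := h.surj (q b)
    exact ⟨⟨(a, b), by simp [ha]⟩, rfl⟩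

/-- The pullback of `f : A → C` and `q : P → C`, projected to `A` when `q` is surjective. -/
lemma pullback_fst {f : A →ₗ[Λ] C} {q : B →ₗ[Λ] C} {k : D →ₗ[Λ] B} (h : IsSES k q) :
    ∃ i : D →ₗ[Λ] LinearMap.ker (f.coprod (-q)),
      IsSES i (LinearMap.fst Λ A B ∘ₗ (LinearMap.ker (f.coprod (-q))).subtype) := by
  have hk : ∀ x, q (k x) = 0 := fun x => (h.exact _).2 ⟨x, rfl⟩
  refine ⟨(LinearMap.inr Λ A B ∘ₗ k).codRestrict _ (by simp [hk]), ?_, ?_, ?_⟩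
  · intro x y hxy
    apply h.inj
    exact congrArg (fun z => z.1.2) hxy
  · rintro ⟨⟨a, b⟩, hab⟩
    simp only [LinearMap.mem_ker, LinearMap.coprod_apply, LinearMap.neg_apply] at hab
    constructor
    · intro ha
      change a = 0 at ha
      subst ha
      obtain ⟨d, rfl⟩ := (h.exact b).1 (by simpa using hab)
      exact ⟨d, rfl⟩
    · rintro ⟨d, hd⟩
      exact (congrArg (fun z => z.1.1) hd).symm
  · intro a
    obtain ⟨b, hb⟩ := h.surj (f a)
    exact ⟨⟨(a, b), by simp [hb]⟩, rfl⟩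

lemma finite_right {f : A →ₗ[Λ] B} {g : B →ₗ[Λ] C} (h : IsSES f g) [Module.Finite Λ B] :
    Module.Finite Λ C :=
  Module.Finite.of_surjective g h.surj

end IsSES

/-- Schanuel's lemma. -/
lemma schanuel {K P M K' P' : Type u} [AddCommGroup K] [Module Λ K] [AddCommGroup P] [Module Λ P]
    [AddCommGroup M] [Module Λ M] [AddCommGroup K'] [Module Λ K'] [AddCommGroup P'] [Module Λ P']
    [Module.Projective Λ P] [Module.Projective Λ P']
    {f : K →ₗ[Λ] P} {g : P →ₗ[Λ] M} {f' : K' →ₗ[Λ] P'} {g' : P' →ₗ[Λ] M}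
    (h : IsSES f g) (h' : IsSES f' g') : Nonempty ((K × P') ≃ₗ[Λ] (K' × P)) := by
  obtain ⟨_, h₁⟩ := h.pullback_snd (q := g')
  obtain ⟨_, h₂⟩ := h'.pullback_fst (f := g)
  obtain ⟨e₁⟩ := h₁.equiv_prod
  obtain ⟨e₂⟩ := h₂.equiv_prod
  exact ⟨e₁.symm.trans e₂⟩

variable (Λ) in
/-- Projective dimension of an unbundled module, as in `HasProjectiveDimensionLT`. -/
abbrev PdLT (M : Type u) [AddCommGroup M] [Module Λ M] (n : ℕ) : Prop :=
  HasProjectiveDimensionLT (ModuleCat.of Λ M) n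

lemma pdLT_one_iff {M : Type u} [AddCommGroup M] [Module Λ M] :
    PdLT Λ M 1 ↔ Module.Projective Λ M := by
  rw [PdLT, ← projective_iff_hasProjectiveDimensionLT_one, ← IsProjective.iff_projective]

/-- `M` is a retract of `N`. -/
def IsRetract (Λ : Type u) [Ring Λ] (M N : Type u) [AddCommGroup M] [Module Λ M] [AddCommGroup N]
    [Module Λ N] : Prop :=
  ∃ (i : M →ₗ[Λ] N) (p : N →ₗ[Λ] M), p ∘ₗ i = LinearMap.id

lemma LinearEquiv.isRetract (e : A ≃ₗ[Λ] B) : IsRetract Λ A B :=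
  ⟨e, e.symm, by ext; simp⟩

lemma IsRetract.pdLT (h : IsRetract Λ A B) {n : ℕ} (hB : PdLT Λ B n) : PdLT Λ A n := by
  obtain ⟨i, p, hip⟩ := h
  refine Retract.hasProjectiveDimensionLT
    (X := ModuleCat.of Λ A) (Y := ModuleCat.of Λ B)
    ⟨ModuleCat.ofHom i, ModuleCat.ofHom p, ?_⟩ n
  ext x
  exact LinearMap.congr_fun hip x

lemma IsRetract.finite (h : IsRetract Λ A B) [Module.Finite Λ B] : Module.Finite Λ A := by
  obtain ⟨i, p, hip⟩ := h
  exact Module.Finite.of_surjective p fun x => ⟨i x, LinearMap.congr_fun hip x⟩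

lemma IsRetract.injective (h : IsRetract Λ A B) (hB : Module.Injective Λ B) :
    Module.Injective Λ A := by
  obtain ⟨i, p, hip⟩ := h
  refine ⟨fun X Y _ _ _ _ f hf g => ?_⟩
  obtain ⟨k, hk⟩ := hB.out f hf (i ∘ₗ g)
  exact ⟨p ∘ₗ k, fun x => by simpa [hk] using LinearMap.congr_fun hip (g x)⟩

lemma IsRetract.projective (h : IsRetract Λ A B) [Module.Projective Λ B] :
    Module.Projective Λ A := by
  obtain ⟨i, p, hip⟩ := h
  exact Module.Projective.of_split i p hip

lemma pdLT_prod {n : ℕ} (hA : PdLT Λ A n) (hB : PdLT Λ B n) : PdLT Λ (A × B) n :=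
  (IsSES.inl_snd Λ A B).shortExact.hasProjectiveDimensionLT_X₂ n hA hB

lemma pdLT_mono {m n : ℕ} (hmn : m ≤ n) (h : PdLT Λ A m) : PdLT Λ A n :=
  hasProjectiveDimensionLT_of_ge _ m n hmn

lemma injective_prod (hA : Module.Injective Λ A) (hB : Module.Injective Λ B) :
    Module.Injective Λ (A × B) := by
  refine ⟨fun X Y _ _ _ _ f hf g => ?_⟩
  obtain ⟨k, hk⟩ := hA.out f hf (.fst Λ A B ∘ₗ g)
  obtain ⟨l, hl⟩ := hB.out f hf (.snd Λ A B ∘ₗ g)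
  exact ⟨k.prod l, fun x => by ext <;> simp [hk, hl]⟩

end ShortExact

section ProjectiveClass

/-- An isomorphism invariant of modules which is additive on finite direct sums of finitely
generated modules. -/
structure AddInvariant (Λ : Type u) [Ring Λ] (G : Type*) [AddCommGroup G] where
  /-- The value of the invariant. -/
  val : ModuleCat.{u} Λ → G
  congr : ∀ {P Q : Type u} [AddCommGroup P] [Module Λ P] [AddCommGroup Q] [Module Λ Q],
    (P ≃ₗ[Λ] Q) → val (.of Λ P) = val (.of Λ Q)
  prod : ∀ (P Q : Type u) [AddCommGroup P] [Module Λ P] [AddCommGroup Q] [Module Λ Q]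
    [Module.Finite Λ P] [Module.Finite Λ Q],
    val (.of Λ (P × Q)) = val (.of Λ P) + val (.of Λ Q)

variable {Λ : Type u} [Ring Λ] {G : Type*} [AddCommGroup G] (τ : AddInvariant Λ G)

/-- `v` is the alternating sum of the values of `τ` on a projective resolution of `M` of length
`d` by finitely generated modules. -/
def IsClass : ℕ → ModuleCat.{u} Λ → G → Prop
  | 0, M, v => Module.Finite Λ M ∧ Module.Projective Λ M ∧ v = τ.val M
  | d + 1, M, v => ∃ (K P : ModuleCat.{u} Λ) (f : K →ₗ[Λ] P) (g : P →ₗ[Λ] M),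
      Module.Finite Λ P ∧ Module.Projective Λ P ∧ IsSES f g ∧ IsClass d K (τ.val P - v)

variable {τ} {M N : Type u} [AddCommGroup M] [Module Λ M] [AddCommGroup N] [Module Λ N]

lemma IsClass.congr (e : M ≃ₗ[Λ] N) {d : ℕ} {v : G} (h : IsClass τ d (.of Λ M) v) :
    IsClass τ d (.of Λ N) v := by
  cases d with
  | zero =>
    obtain ⟨h₁, h₂, rfl⟩ := h
    exact ⟨Module.Finite.equiv e, Module.Projective.of_equiv e, τ.congr e⟩
  | succ d =>
    obtain ⟨K, P, f, g, hP, hP', h, hK⟩ := h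
    exact ⟨K, P, f, _, hP, hP', h.comp_equiv e, hK⟩

lemma IsClass.succ {d : ℕ} {v : G} (h : IsClass τ d (.of Λ M) v) :
    IsClass τ (d + 1) (.of Λ M) v := by
  induction d generalizing M v with
  | zero =>
    obtain ⟨h₁, h₂, rfl⟩ := h
    have h0 : τ.val (.of Λ PUnit.{u + 1}) = 0 := by
      have e : (PUnit.{u + 1} × PUnit.{u + 1}) ≃ₗ[Λ] PUnit.{u + 1} :=
        ⟨⟨⟨fun _ => 0, fun _ _ => rfl⟩, fun _ _ => rfl⟩, fun _ => 0, fun _ => rfl, fun _ => rfl⟩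
      have := τ.prod PUnit.{u + 1} PUnit.{u + 1}
      rw [τ.congr e] at this
      simpa using this
    refine ⟨.of Λ PUnit.{u + 1}, .of Λ M, 0, LinearMap.id, h₁, h₂,
      ⟨fun _ _ _ => rfl, fun x => ?_, fun x => ⟨x, rfl⟩⟩, ?_, ?_, ?_⟩
    · simp [eq_comm]
    · change Module.Finite Λ PUnit.{u + 1}
      infer_instance
    · change Module.Projective Λ PUnit.{u + 1}
      infer_instance
    · rw [h0]; exact sub_self _
  | succ d ih =>
    obtain ⟨K, P, f, g, hP, hP', h, hK⟩ := h
    exact ⟨K, P, f, g, hP, hP', h, ih (M := K) hK⟩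

lemma IsClass.prod [Module.Finite Λ N] [Module.Projective Λ N] {d : ℕ} {v : G}
    (h : IsClass τ d (.of Λ M) v) : IsClass τ d (.of Λ (M × N)) (v + τ.val (.of Λ N)) := by
  cases d with
  | zero =>
    obtain ⟨h₁, h₂, rfl⟩ := h
    have : Module.Finite Λ M := h₁
    have : Module.Projective Λ M := h₂
    refine ⟨?_, ?_, (τ.prod M N).symm⟩
    · change Module.Finite Λ (M × N); infer_instance
    · change Module.Projective Λ (M × N); infer_instance
  | succ d =>
    obtain ⟨K, P, f, g, hP, hP', h, hK⟩ := h
    have hid : IsSES (0 : PUnit.{u + 1} →ₗ[Λ] N) (LinearMap.id : N →ₗ[Λ] N) :=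
      ⟨fun _ _ _ => rfl, fun x => by simp [eq_comm], fun x => ⟨x, rfl⟩⟩
    let e : K ≃ₗ[Λ] (K × PUnit.{u + 1}) := LinearEquiv.prodUnique.symm
    refine ⟨K, .of Λ (P × N), _, _, ?_, ?_, (h.prodMap hid).equiv_comp e, ?_⟩
    · change Module.Finite Λ (P × N); infer_instance
    · change Module.Projective Λ (P × N); infer_instance
    · rw [τ.prod P N, add_sub_add_right_eq_sub]
      exact hK

lemma IsClass.unique {d : ℕ} {v w : G} (hv : IsClass τ d (.of Λ M) v)
    (hw : IsClass τ d (.of Λ M) w) : v = w := by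
  induction d generalizing M v w with
  | zero => exact hv.2.2.trans hw.2.2.symm
  | succ d ih =>
    obtain ⟨K, P, f, g, hP, hP', h, hK⟩ := hv
    obtain ⟨K', Q, f', g', hQ, hQ', h', hK'⟩ := hw
    obtain ⟨e⟩ := schanuel h h'
    have h₁ := ih ((IsClass.prod (M := K) (N := Q) hK).congr e)
      (IsClass.prod (M := K') (N := P) hK')
    change τ.val P - v + τ.val Q = τ.val Q - w + τ.val P at h₁
    have : v - w = 0 := by
      rw [← sub_eq_zero.2 h₁.symm]; abel
    exact sub_eq_zero.1 this

lemma IsClass.mono {d e : ℕ} (hde : d ≤ e) {v : G} (h : IsClass τ d (.of Λ M) v) :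
    IsClass τ e (.of Λ M) v := by
  induction e, hde using Nat.le_induction with
  | base => exact h
  | succ e _ ih => exact ih.succ

lemma IsClass.unique' {d e : ℕ} {v w : G} (hv : IsClass τ d (.of Λ M) v)
    (hw : IsClass τ e (.of Λ M) w) : v = w :=
  (hv.mono (le_max_left d e)).unique (hw.mono (le_max_right d e))

/-- `M` is finitely generated of finite projective dimension. -/
def FinPd (Λ : Type u) [Ring Λ] (M : Type u) [AddCommGroup M] [Module Λ M] : Prop :=
  Module.Finite Λ M ∧ ∃ d, PdLT Λ M d

lemma FinPd.of_projective [Module.Finite Λ M] [Module.Projective Λ M] : FinPd Λ M :=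
  ⟨‹_›, 1, pdLT_one_iff.2 ‹_›⟩

lemma IsRetract.finPd (h : IsRetract Λ M N) (hN : FinPd Λ N) : FinPd Λ M := by
  obtain ⟨_, d, hd⟩ := hN
  exact ⟨h.finite, d, h.pdLT hd⟩

lemma FinPd.prod (hM : FinPd Λ M) (hN : FinPd Λ N) : FinPd Λ (M × N) := by
  obtain ⟨_, d, hd⟩ := hM
  obtain ⟨_, e, he⟩ := hN
  exact ⟨inferInstance, max d e, pdLT_prod (pdLT_mono (le_max_left _ _) hd)
    (pdLT_mono (le_max_right _ _) he)⟩

lemma IsSES.finPd_right {C : Type u} [AddCommGroup C] [Module Λ C] {f : M →ₗ[Λ] N}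
    {g : N →ₗ[Λ] C} (h : IsSES f g) (hM : FinPd Λ M) (hN : FinPd Λ N) : FinPd Λ C := by
  obtain ⟨_, d, hd⟩ := hM
  obtain ⟨_, e, he⟩ := hN
  exact ⟨h.finite_right, d + e + 1, h.shortExact.hasProjectiveDimensionLT_X₃ (d + e)
    (pdLT_mono (by omega) hd) (pdLT_mono (by omega) he)⟩

open Classical in
variable (τ M) in
/-- The class of a module of finite projective dimension with respect to `τ`. -/
noncomputable def cls : G :=
  if h : ∃ v d, IsClass τ d (.of Λ M) v then h.choose else 0

lemma IsClass.cls_eq {d : ℕ} {v : G} (h : IsClass τ d (.of Λ M) v) : cls τ M = v := by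
  have h' : ∃ v d, IsClass τ d (.of Λ M) v := ⟨v, d, h⟩
  rw [cls, dif_pos h']
  exact h'.choose_spec.choose_spec.unique' h

lemma cls_projective [Module.Finite Λ M] [Module.Projective Λ M] :
    cls τ M = τ.val (.of Λ M) :=
  IsClass.cls_eq (d := 0) ⟨‹_›, ‹_›, rfl⟩

variable [IsNoetherianRing Λ]

variable (τ) in
lemma exists_isClass {d : ℕ} [Module.Finite Λ M] (h : PdLT Λ M (d + 1)) :
    ∃ v, IsClass τ d (.of Λ M) v := by
  induction d generalizing M with
  | zero => exact ⟨_, ‹_›, pdLT_one_iff.1 h, rfl⟩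
  | succ d ih =>
    obtain ⟨k, g, hg⟩ := Module.Finite.exists_fin' Λ M
    have hses := IsSES.ker hg
    have hK : PdLT Λ (LinearMap.ker g) (d + 1) :=
      hses.shortExact.hasProjectiveDimensionLT_X₁ (d + 1)
        (pdLT_mono (by omega) (pdLT_one_iff.2 inferInstance : PdLT Λ (Fin k → Λ) 1)) h
    obtain ⟨v, hv⟩ := ih hK
    refine ⟨τ.val (.of Λ (Fin k → Λ)) - v, .of Λ (LinearMap.ker g), .of Λ (Fin k → Λ), _, _,
      ?_, ?_, hses, ?_⟩
    · change Module.Finite Λ (Fin k → Λ); infer_instance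
    · change Module.Projective Λ (Fin k → Λ); infer_instance
    · rwa [sub_sub_cancel]

lemma isClass_cls {d : ℕ} [Module.Finite Λ M] (h : PdLT Λ M (d + 1)) :
    IsClass τ d (.of Λ M) (cls τ M) := by
  obtain ⟨v, hv⟩ := exists_isClass τ h
  rwa [hv.cls_eq]

lemma FinPd.isClass (h : FinPd Λ M) : ∃ d, IsClass τ d (.of Λ M) (cls τ M) := by
  obtain ⟨_, d, hd⟩ := h
  exact ⟨d, isClass_cls (pdLT_mono (by omega) hd)⟩

lemma cls_congr (e : M ≃ₗ[Λ] N) (h : FinPd Λ M) : cls τ M = cls τ N := by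
  obtain ⟨d, hd⟩ := h.isClass (τ := τ)
  exact (hd.congr e).cls_eq.symm

lemma cls_prod_projective [Module.Finite Λ N] [Module.Projective Λ N] (h : FinPd Λ M) :
    cls τ (M × N) = cls τ M + τ.val (.of Λ N) := by
  obtain ⟨d, hd⟩ := h.isClass (τ := τ)
  exact hd.prod.cls_eq

lemma cls_syzygy {K P : Type u} [AddCommGroup K] [Module Λ K] [AddCommGroup P] [Module Λ P]
    [Module.Finite Λ P] [Module.Projective Λ P] {f : K →ₗ[Λ] P} {g : P →ₗ[Λ] M} (h : IsSES f g)
    (hK : FinPd Λ K) : cls τ M = τ.val (.of Λ P) - cls τ K := by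
  obtain ⟨d, hd⟩ := hK.isClass (τ := τ)
  refine IsClass.cls_eq (d := d + 1) ⟨.of Λ K, .of Λ P, f, g, ‹_›, ‹_›, h, ?_⟩
  rwa [sub_sub_cancel]

section

variable {A B C : Type u} [AddCommGroup A] [Module Λ A] [AddCommGroup B] [Module Λ B]
  [AddCommGroup C] [Module Λ C]

lemma IsSES.finite_left {f : A →ₗ[Λ] B} {g : B →ₗ[Λ] C} (h : IsSES f g) [Module.Finite Λ B] :
    Module.Finite Λ A :=
  Module.Finite.of_injective f h.inj

lemma IsSES.finPd_left {f : A →ₗ[Λ] B} {g : B →ₗ[Λ] C} (h : IsSES f g) (hB : FinPd Λ B)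
    (hC : FinPd Λ C) : FinPd Λ A := by
  obtain ⟨_, d, hd⟩ := hB
  obtain ⟨_, e, he⟩ := hC
  exact ⟨h.finite_left, d + e, h.shortExact.hasProjectiveDimensionLT_X₁ (d + e)
    (pdLT_mono (by omega) hd) (pdLT_mono (by omega) he)⟩

/-- If classes are additive when the right hand term has projective dimension at most `d`, they are
additive when the left hand term does. -/
lemma cls_add_of_left {d : ℕ}
    (ih : ∀ {A B C : Type u} [AddCommGroup A] [Module Λ A] [AddCommGroup B] [Module Λ B]
      [AddCommGroup C] [Module Λ C] {f : A →ₗ[Λ] B} {g : B →ₗ[Λ] C}, IsSES f g → FinPd Λ A →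
      FinPd Λ B → FinPd Λ C → PdLT Λ C (d + 1) → cls τ B = cls τ A + cls τ C)
    {f : A →ₗ[Λ] B} {g : B →ₗ[Λ] C} (h : IsSES f g) (hA : FinPd Λ A) (hB : FinPd Λ B)
    (hC : FinPd Λ C) (hd : PdLT Λ A (d + 1)) : cls τ B = cls τ A + cls τ C := by
  have := hB.1
  obtain ⟨k, q, hq⟩ := Module.Finite.exists_fin' Λ B
  have hK := IsSES.ker hq
  have hP : FinPd Λ (Fin k → Λ) := .of_projective
  have hKpd := hK.finPd_left hP hB
  obtain ⟨i, hi⟩ := hK.pullback_fst (f := f)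
  have hW : IsSES (LinearMap.snd Λ A (Fin k → Λ) ∘ₗ (LinearMap.ker (f.coprod (-q))).subtype)
      (g ∘ₗ q) := by
    refine ⟨?_, ?_, h.surj.comp hq⟩
    · rw [← LinearMap.ker_eq_bot, LinearMap.ker_eq_bot']
      rintro ⟨⟨a, b⟩, hab⟩ hb
      change b = 0 at hb
      subst hb
      have : f a = f 0 := by simpa using hab
      have := h.inj this
      subst this
      rfl
    · intro p
      constructor
      · intro hp
        obtain ⟨a, ha⟩ := (h.exact (q p)).1 hp
        exact ⟨⟨(a, p), by simp [ha]⟩, rfl⟩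
      · rintro ⟨⟨⟨a, b⟩, hab⟩, rfl⟩
        have : f a = q b := by simpa [add_neg_eq_zero] using hab
        exact (h.exact _).2 ⟨a, this⟩
  have hWpd := hW.finPd_left hP hC
  have e₁ := cls_syzygy (τ := τ) hW hWpd
  have e₂ := cls_syzygy (τ := τ) hK hKpd
  have e₃ := ih hi hKpd hWpd hA hd
  rw [e₁, e₂, e₃]
  abel

lemma cls_add_of_right {d : ℕ} {f : A →ₗ[Λ] B} {g : B →ₗ[Λ] C} (h : IsSES f g)
    (hA : FinPd Λ A) (hB : FinPd Λ B) (hC : FinPd Λ C) (hd : PdLT Λ C (d + 1)) :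
    cls τ B = cls τ A + cls τ C := by
  induction d generalizing A B C with
  | zero =>
    have := pdLT_one_iff.1 hd
    have := hC.1
    obtain ⟨e⟩ := h.equiv_prod
    rw [cls_congr e hB, cls_prod_projective hA, cls_projective (M := C)]
  | succ d ih =>
    have := hC.1
    obtain ⟨k, q, hq⟩ := Module.Finite.exists_fin' Λ C
    have hP : FinPd Λ (Fin k → Λ) := .of_projective
    obtain ⟨r, hr⟩ := Module.projective_lifting_property g q h.surj
    have hr : ∀ p, g (r p) = q p := LinearMap.congr_fun hr
    have hgf : ∀ a, g (f a) = 0 := fun a => (h.exact _).2 ⟨a, rfl⟩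
    have hs : Function.Surjective (f.coprod r) := by
      intro b
      obtain ⟨p, hp⟩ := hq (g b)
      obtain ⟨a, ha⟩ := (h.exact (b - r p)).1 (by rw [map_sub, hr, hp, sub_self])
      exact ⟨(a, p), by simp [ha]⟩
    have hW := IsSES.ker hs
    have hW' : IsSES (LinearMap.snd Λ A (Fin k → Λ) ∘ₗ (LinearMap.ker (f.coprod r)).subtype)
        q := by
      refine ⟨?_, ?_, hq⟩
      · rw [← LinearMap.ker_eq_bot, LinearMap.ker_eq_bot']
        rintro ⟨⟨a, b⟩, hab⟩ hb
        change b = 0 at hb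
        subst hb
        have : f a = f 0 := by simpa using hab
        have := h.inj this
        subst this
        rfl
      · intro p
        constructor
        · intro hp
          obtain ⟨a, ha⟩ := (h.exact (r p)).1 (by rw [hr, hp])
          exact ⟨⟨(-a, p), by simp [ha]⟩, rfl⟩
        · rintro ⟨⟨⟨a, b⟩, hab⟩, rfl⟩
          have hab : f a + r b = 0 := by simpa using hab
          have := congrArg g hab
          rw [map_add, hgf, hr, zero_add, map_zero] at this
          exact this
    have hWpd := hW'.finPd_left hP hC
    have hWd : PdLT Λ (LinearMap.ker (f.coprod r)) (d + 1) :=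
      hW'.shortExact.hasProjectiveDimensionLT_X₁ (d + 1)
        (pdLT_mono (by omega) (pdLT_one_iff.2 inferInstance : PdLT Λ (Fin k → Λ) 1)) hd
    have e₁ := cls_syzygy (τ := τ) hW' hWpd
    have e₂ := cls_add_of_left (τ := τ) ih hW hWpd (hA.prod hP) hB hWd
    rw [cls_prod_projective hA] at e₂
    rw [e₁, ← add_sub_assoc, e₂, add_sub_cancel_left]

/-- Classes are additive on short exact sequences. -/
lemma cls_add {f : A →ₗ[Λ] B} {g : B →ₗ[Λ] C} (h : IsSES f g)
    (hA : FinPd Λ A) (hB : FinPd Λ B) (hC : FinPd Λ C) : cls τ B = cls τ A + cls τ C := by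
  obtain ⟨d, hd⟩ := hC.2
  exact cls_add_of_right (d := d) h hA hB hC (pdLT_mono (by omega) hd)

end

end ProjectiveClass

section Simple

variable {Λ : Type u} [Ring Λ] {M N P S T : Type u} [AddCommGroup M] [Module Λ M]
  [AddCommGroup N] [Module Λ N] [AddCommGroup P] [Module Λ P] [AddCommGroup S] [Module Λ S]
  [AddCommGroup T] [Module Λ T]

lemma Submodule.isRetract_of_isCompl {p q : Submodule Λ M} (h : IsCompl p q) : IsRetract Λ p M :=
  ⟨p.subtype, p.projectionOnto q h, Submodule.projectionOnto_comp_subtype h⟩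

/-- Some power of an endomorphism of a module of finite length gives a direct sum decomposition. -/
lemma exists_fitting [IsNoetherian Λ M] [IsArtinian Λ M] (φ : Module.End Λ M) :
    ∃ n : ℕ, n ≠ 0 ∧ IsCompl (LinearMap.ker (φ ^ n)) (LinearMap.range (φ ^ n)) := by
  obtain ⟨n, hn, hn'⟩ := (φ.eventually_isCompl_ker_pow_range_pow.and
    (Filter.eventually_gt_atTop 0)).exists
  exact ⟨n, hn'.ne', hn⟩

lemma LinearMap.range_pow_le (φ : Module.End Λ M) {n : ℕ} (hn : n ≠ 0) :
    LinearMap.range (φ ^ n) ≤ LinearMap.range φ := by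
  obtain ⟨n, rfl⟩ := Nat.exists_eq_succ_of_ne_zero hn
  rw [pow_succ']
  exact LinearMap.range_comp_le_range _ _

/-- A nonzero map to a simple module `S` from a projective module which also maps to another simple
module restricts to a proper direct summand. -/
lemma exists_smaller_projective [IsArtinianRing Λ] [Module.Finite Λ P] [Module.Projective Λ P]
    [IsSimpleModule Λ S] [IsSimpleModule Λ T] {f : P →ₗ[Λ] S} (hf : f ≠ 0) {g : P →ₗ[Λ] T}
    (hg : g ≠ 0) (hST : ¬ Nonempty (T ≃ₗ[Λ] S)) :
    ∃ Q : Submodule Λ P, Q ≠ ⊤ ∧ IsRetract Λ Q P ∧ f ∘ₗ Q.subtype ≠ 0 := by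
  have hfc := LinearMap.isCoatom_ker_of_surjective (LinearMap.surjective_of_ne_zero hf)
  have hgc := LinearMap.isCoatom_ker_of_surjective (LinearMap.surjective_of_ne_zero hg)
  have hne : f ∘ₗ (LinearMap.ker g).subtype ≠ 0 := by
    intro h0
    have hle : LinearMap.ker g ≤ LinearMap.ker f := fun x hx =>
      LinearMap.congr_fun h0 ⟨x, hx⟩
    have heq : LinearMap.ker g = LinearMap.ker f := by
      by_contra hne
      exact hfc.1 (hgc.2 _ (lt_of_le_of_ne hle hne))
    exact hST ⟨((g.quotKerEquivOfSurjective (LinearMap.surjective_of_ne_zero hg)).symm.trans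
      (Submodule.quotEquivOfEq _ _ heq)).trans
      (f.quotKerEquivOfSurjective (LinearMap.surjective_of_ne_zero hf))⟩
  obtain ⟨φ, hφ⟩ := Module.projective_lifting_property _ f (LinearMap.surjective_of_ne_zero hne)
  let ψ : Module.End Λ P := (LinearMap.ker g).subtype ∘ₗ φ
  have hψ : f ∘ₗ ψ = f := hφ
  have hψn : ∀ n : ℕ, f ∘ₗ (ψ ^ n) = f := by
    intro n
    induction n with
    | zero => rfl
    | succ n ih =>
      rw [pow_succ]
      change (f ∘ₗ (ψ ^ n)) ∘ₗ ψ = f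
      rw [ih, hψ]
  obtain ⟨n, hn, hc⟩ := exists_fitting ψ
  refine ⟨LinearMap.range (ψ ^ n), ?_, Submodule.isRetract_of_isCompl hc.symm, ?_⟩
  · intro htop
    refine hgc.1 (top_le_iff.1 ?_)
    rw [← htop]
    refine (LinearMap.range_pow_le ψ hn).trans ?_
    rintro _ ⟨x, rfl⟩
    exact (φ x).2
  · intro h0
    apply hf
    rw [← hψn n]
    ext x
    exact LinearMap.congr_fun h0 ⟨_, x, rfl⟩

/-- Over an artinian ring, every simple module is the only simple quotient of some finitely
generated projective module. -/
lemma exists_projective_of_simple [IsArtinianRing Λ] (S : Type u) [AddCommGroup S] [Module Λ S]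
    [IsSimpleModule Λ S] :
    ∃ P : ModuleCat.{u} Λ, Module.Finite Λ P ∧ Module.Projective Λ P ∧
      (∃ f : P →ₗ[Λ] S, f ≠ 0) ∧
      ∀ (T : Type u) [AddCommGroup T] [Module Λ T], IsSimpleModule Λ T →
        (∃ g : P →ₗ[Λ] T, g ≠ 0) → Nonempty (T ≃ₗ[Λ] S) := by
  by_contra! H
  have key : ∀ (l : ℕ∞) (P : Type u) [AddCommGroup P] [Module Λ P] [Module.Finite Λ P]
      [Module.Projective Λ P], Module.length Λ P = l → ∀ f : P →ₗ[Λ] S, f = 0 := by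
    intro l
    induction l using WellFoundedLT.induction with
    | ind l ih =>
      rintro P _ _ _ _ rfl f
      by_contra hf
      obtain ⟨T, _, _, _, ⟨g, hg⟩, hT⟩ := H (.of Λ P) ‹_› ‹_› ⟨f, hf⟩
      obtain ⟨Q, hQ, hr, hQf⟩ := exists_smaller_projective hf hg (not_nonempty_iff.2 hT)
      have := hr.finite
      have := hr.projective
      exact hQf (ih _ (Submodule.length_lt hQ) Q rfl _)
  have := IsSimpleModule.nontrivial Λ S
  obtain ⟨s, hs⟩ := exists_ne (0 : S)
  exact hs (by simpa using LinearMap.congr_fun (key _ Λ rfl (LinearMap.toSpanSingleton Λ S s)) 1)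

lemma exists_simple_submodule_jacobson [IsArtinianRing Λ] [IsSimpleModule Λ S] :
    ∃ N : Submodule Λ (Λ ⧸ Module.jacobson Λ Λ), Nonempty (N ≃ₗ[Λ] S) := by
  have : IsSemisimpleModule Λ (Λ ⧸ Module.jacobson Λ Λ) :=
    (IsArtinian.isSemisimpleModule_iff_jacobson Λ _).2 (Module.jacobson_quotient_jacobson Λ Λ)
  have := IsSimpleModule.nontrivial Λ S
  obtain ⟨s, hs⟩ := exists_ne (0 : S)
  have hsurj := IsSimpleModule.toSpanSingleton_surjective Λ hs
  have hle : Module.jacobson Λ Λ ≤ LinearMap.ker (LinearMap.toSpanSingleton Λ S s) :=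
    sInf_le (LinearMap.isCoatom_ker_of_surjective hsurj)
  let q := (Module.jacobson Λ Λ).liftQ _ hle
  have hq : Function.Surjective q := by
    rw [← LinearMap.range_eq_top, Submodule.range_liftQ, LinearMap.range_eq_top]
    exact hsurj
  obtain ⟨N, ⟨e⟩⟩ := IsSemisimpleModule.exists_submodule_linearEquiv_quotient (LinearMap.ker q)
  exact ⟨N, ⟨e.trans (q.quotKerEquivOfSurjective hq)⟩⟩

variable (Λ) in
/-- Over an artinian ring there are finitely many simple modules up to isomorphism. -/
lemma exists_simples [IsArtinianRing Λ] :
    ∃ (ι : Type u) (_ : Fintype ι) (S : ι → Submodule Λ (Λ ⧸ Module.jacobson Λ Λ)),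
      (∀ i, IsSimpleModule Λ (S i)) ∧ (∀ i j, Nonempty (S i ≃ₗ[Λ] S j) → i = j) ∧
      ∀ (T : Type u) [AddCommGroup T] [Module Λ T], IsSimpleModule Λ T →
        ∃ i, Nonempty (T ≃ₗ[Λ] S i) := by
  have h : ∀ c : isotypicComponents Λ (Λ ⧸ Module.jacobson Λ Λ), ∃ S : Submodule Λ (Λ ⧸
    Module.jacobson Λ Λ), IsSimpleModule Λ S ∧ isotypicComponent Λ _ S = c.1 := fun c => by
      obtain ⟨S, hS, h⟩ := c.2
      exact ⟨S, hS, h.symm⟩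
  choose S hS hc using h
  refine ⟨_, Fintype.ofFinite _, S, hS, fun i j ⟨e⟩ => ?_, fun T _ _ hT => ?_⟩
  · apply Subtype.ext
    rw [← hc, ← hc]
    exact LinearEquiv.isotypicComponent_eq e
  · obtain ⟨N, ⟨e⟩⟩ := exists_simple_submodule_jacobson (Λ := Λ) (S := T)
    have hN : IsSimpleModule Λ N := IsSimpleModule.congr e
    let c : isotypicComponents Λ (Λ ⧸ Module.jacobson Λ Λ) := ⟨_, N, hN, rfl⟩
    have h1 : S c ≤ isotypicComponent Λ _ N := (S c).le_isotypicComponent.trans_eq (hc c)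
    have := hS c
    obtain ⟨e'⟩ := isIsotypicOfType_submodule_iff.1
      (IsIsotypicOfType.isotypicComponent Λ (Λ ⧸ Module.jacobson Λ Λ) N) (S c) h1
    exact ⟨c, ⟨e.symm.trans e'.symm⟩⟩

end Simple

section Counting

variable {Λ : Type u} [Ring Λ]

section HomInvariant

variable (R : Type u) [CommRing R] [IsArtinianRing R] [Algebra R Λ]

lemma finite_linearMap (M S : Type u) [AddCommGroup M] [Module Λ M] [Module.Finite Λ M]
    [AddCommGroup S] [Module Λ S] [Module R S] [IsScalarTower R Λ S] [Module.Finite R S] :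
    Module.Finite R (M →ₗ[Λ] S) := by
  obtain ⟨k, q, hq⟩ := Module.Finite.exists_fin' Λ M
  let F : (M →ₗ[Λ] S) →ₗ[R] (Fin k → S) :=
    { toFun := fun φ i => φ (q (Pi.single i 1))
      map_add' := fun _ _ => rfl
      map_smul' := fun _ _ => rfl }
  refine Module.Finite.of_injective F fun φ ψ h => ?_
  have : φ ∘ₗ q = ψ ∘ₗ q := by
    ext i
    exact congrFun h i
  ext x
  obtain ⟨y, rfl⟩ := hq x
  exact LinearMap.congr_fun this y

variable {ι : Type u} (S : ι → Type u) [∀ i, AddCommGroup (S i)] [∀ i, Module Λ (S i)]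
  [∀ i, Module R (S i)] [∀ i, IsScalarTower R Λ (S i)] [∀ i, Module.Finite R (S i)]

/-- The lengths of the homomorphism modules to a family of modules. -/
noncomputable def homInvariant : AddInvariant Λ (ι → ℚ) where
  val M i := (Module.length R (M →ₗ[Λ] S i)).toNat
  congr {P Q} _ _ _ _ e := by
    funext i
    let F : (P →ₗ[Λ] S i) ≃ₗ[R] (Q →ₗ[Λ] S i) :=
      { toFun := fun φ => φ ∘ₗ e.symm.toLinearMap
        invFun := fun φ => φ ∘ₗ e.toLinearMap
        map_add' := fun _ _ => rfl
        map_smul' := fun _ _ => rfl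
        left_inv := fun φ => by ext; simp
        right_inv := fun φ => by ext; simp }
    exact congrArg (fun l : ℕ∞ => (l.toNat : ℚ)) F.length_eq
  prod P Q _ _ _ _ _ _ := by
    funext i
    have h1 := finite_linearMap (Λ := Λ) R P (S i)
    have h2 := finite_linearMap (Λ := Λ) R Q (S i)
    have h3 := LinearEquiv.length_eq (LinearMap.coprodEquiv R : ((P →ₗ[Λ] S i) × (Q →ₗ[Λ] S i))
      ≃ₗ[R] (P × Q →ₗ[Λ] S i))
    rw [Module.length_prod] at h3
    rw [← h3, ENat.toNat_add Module.length_ne_top Module.length_ne_top]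
    push_cast
    rfl

variable {R S}

lemma homInvariant_apply (M : ModuleCat.{u} Λ) (i : ι) : (homInvariant R S).val M i =
    (Module.length R (M →ₗ[Λ] S i)).toNat := rfl

lemma homInvariant_eq_zero {P : Type u} [AddCommGroup P] [Module Λ P] {i : ι}
    (h : ∀ f : P →ₗ[Λ] S i, f = 0) : (homInvariant R S).val (.of Λ P) i = 0 := by
  have : Subsingleton (P →ₗ[Λ] S i) := ⟨fun f g => (h f).trans (h g).symm⟩
  simp [homInvariant_apply, Module.length_eq_zero]

lemma homInvariant_ne_zero {P : Type u} [AddCommGroup P] [Module Λ P] [Module.Finite Λ P] {i : ι}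
    {f : P →ₗ[Λ] S i} (h : f ≠ 0) : (homInvariant R S).val (.of Λ P) i ≠ 0 := by
  have := finite_linearMap (Λ := Λ) R P (S i)
  have : Nontrivial (P →ₗ[Λ] S i) := ⟨f, 0, h⟩
  rw [homInvariant_apply, Nat.cast_ne_zero, ne_eq, ENat.toNat_eq_zero, not_or]
  exact ⟨(Module.length_pos (R := R)).ne', Module.length_ne_top⟩

end HomInvariant

section Good

variable {A B C M S S₀ T : Type u} [AddCommGroup A] [Module Λ A] [AddCommGroup B] [Module Λ B]
  [AddCommGroup C] [Module Λ C] [AddCommGroup M] [Module Λ M] [AddCommGroup S] [Module Λ S]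
  [AddCommGroup S₀] [Module Λ S₀] [AddCommGroup T] [Module Λ T]

lemma IsSES.desc {f : A →ₗ[Λ] B} {g : B →ₗ[Λ] C} (h : IsSES f g) (q : B →ₗ[Λ] M)
    (hq : q ∘ₗ f = 0) : ∃ q' : C →ₗ[Λ] M, ∀ x, q' (g x) = q x := by
  have hle : LinearMap.ker g ≤ LinearMap.ker q := by
    intro x hx
    obtain ⟨a, rfl⟩ := (h.exact x).1 hx
    exact LinearMap.congr_fun hq a
  refine ⟨(LinearMap.ker g).liftQ q hle ∘ₗ (g.quotKerEquivOfSurjective h.surj).symm.toLinearMap,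
    fun x => ?_⟩
  have : (g.quotKerEquivOfSurjective h.surj).symm (g x) = (LinearMap.ker g).mkQ x := by
    rw [LinearEquiv.symm_apply_eq]
    rfl
  simp [this]

lemma IsSES.isRetract_right {f : A →ₗ[Λ] B} {g : B →ₗ[Λ] C} (h : IsSES f g) {r : B →ₗ[Λ] A}
    (hr : r ∘ₗ f = LinearMap.id) : IsRetract Λ C B := by
  obtain ⟨s, hs⟩ := h.desc (LinearMap.id - f ∘ₗ r) (by
    ext a
    simpa [sub_eq_zero] using congrArg f (LinearMap.congr_fun hr a).symm)
  refine ⟨s, g, ?_⟩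
  ext c
  obtain ⟨b, rfl⟩ := h.surj c
  have : g (f (r b)) = 0 := (h.exact _).2 ⟨_, rfl⟩
  simp [hs, this]

/-- `J` is a finitely generated injective module of finite projective dimension which admits no
nonzero map from `S₀`. -/
def IsGood (Λ : Type u) [Ring Λ] (S₀ J : Type u) [AddCommGroup S₀] [Module Λ S₀] [AddCommGroup J]
    [Module Λ J] : Prop :=
  FinPd Λ J ∧ Module.Injective Λ J ∧ ∀ f : S₀ →ₗ[Λ] J, f = 0

lemma IsRetract.hom_eq_zero (h : IsRetract Λ A B) (hB : ∀ f : S₀ →ₗ[Λ] B, f = 0)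
    (f : S₀ →ₗ[Λ] A) : f = 0 := by
  obtain ⟨i, p, hip⟩ := h
  rw [← LinearMap.id_comp f, ← hip, LinearMap.comp_assoc, hB (i ∘ₗ f), LinearMap.comp_zero]

lemma IsRetract.isGood (h : IsRetract Λ A B) (hB : IsGood Λ S₀ B) : IsGood Λ S₀ A :=
  ⟨h.finPd hB.1, h.injective hB.2.1, h.hom_eq_zero hB.2.2⟩

lemma hom_prod_eq_zero (hA : ∀ f : S₀ →ₗ[Λ] A, f = 0) (hB : ∀ f : S₀ →ₗ[Λ] B, f = 0)
    (f : S₀ →ₗ[Λ] A × B) : f = 0 := by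
  ext x
  · exact LinearMap.congr_fun (hA (.fst Λ A B ∘ₗ f)) x
  · exact LinearMap.congr_fun (hB (.snd Λ A B ∘ₗ f)) x

lemma IsGood.prod (hA : IsGood Λ S₀ A) (hB : IsGood Λ S₀ B) : IsGood Λ S₀ (A × B) :=
  ⟨hA.1.prod hB.1, injective_prod hA.2.1 hB.2.1, hom_prod_eq_zero hA.2.2 hB.2.2⟩

/-- An injective module of minimal length among those containing a simple module `S` is a direct
summand of all of them. -/
lemma IsGood.isRetract_of_minimal [IsSimpleModule Λ S] [IsArtinianRing Λ] {E : Type u}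
    [AddCommGroup E] [Module Λ E] (hE : IsGood Λ S₀ E) (hT : IsGood Λ S₀ T) {v : S →ₗ[Λ] E}
    (hv : v ≠ 0) {u : S →ₗ[Λ] T} (hu : u ≠ 0)
    (hmin : ∀ (E' : Type u) [AddCommGroup E'] [Module Λ E'], IsGood Λ S₀ E' →
      (∃ f : S →ₗ[Λ] E', f ≠ 0) → Module.length Λ E ≤ Module.length Λ E') :
    ∃ (a : E →ₗ[Λ] T) (r : T →ₗ[Λ] E), r ∘ₗ a = LinearMap.id := by
  have := hE.1.1
  have hv' := LinearMap.injective_of_ne_zero hv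
  have hu' := LinearMap.injective_of_ne_zero hu
  obtain ⟨a, ha⟩ := hT.2.1.out v hv' u
  obtain ⟨b, hb⟩ := hE.2.1.out u hu' v
  let ψ : Module.End Λ E := b ∘ₗ a
  have hψ : ∀ x, ψ (v x) = v x := fun x => (congrArg b (ha x)).trans (hb x)
  have hψn : ∀ (n : ℕ) x, (ψ ^ n) (v x) = v x := by
    intro n x
    induction n with
    | zero => rfl
    | succ n ih => rw [pow_succ, Module.End.mul_apply, hψ, ih]
  obtain ⟨n, hn, hc⟩ := exists_fitting ψ
  have htop : LinearMap.range (ψ ^ n) = ⊤ := by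
    by_contra hne
    refine (Submodule.length_lt hne).not_ge (hmin _
      ((Submodule.isRetract_of_isCompl hc.symm).isGood hE)
      ⟨v.codRestrict _ fun x => ⟨v x, hψn n x⟩, fun h0 => hv ?_⟩)
    ext x
    exact congrArg Subtype.val (LinearMap.congr_fun h0 x)
  have hsurj : Function.Surjective ψ := by
    rw [← LinearMap.range_eq_top, ← top_le_iff, ← htop]
    exact LinearMap.range_pow_le ψ hn
  let e := LinearEquiv.ofBijective ψ ⟨IsNoetherian.injective_of_surjective_endomorphism ψ hsurj,
    hsurj⟩
  refine ⟨a, e.symm.toLinearMap ∘ₗ b, ?_⟩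
  ext x
  exact e.symm_apply_apply x

lemma exists_simple_submodule_of_nontrivial [IsArtinian Λ M] [Nontrivial M] :
    ∃ N : Submodule Λ M, IsSimpleModule Λ N := by
  obtain ⟨N, hN, -⟩ := (eq_bot_or_exists_atom_le (⊤ : Submodule Λ M)).resolve_left top_ne_bot
  exact ⟨N, isSimpleModule_iff_isAtom.2 hN⟩

variable (Λ) in
/-- The classes of the modules satisfying `IsGood` are spanned by one class for each simple module
different from `S i₀`. -/
lemma exists_span_isGood [IsArtinianRing Λ] {ι : Type u} (S : ι → Type u)
    [∀ i, AddCommGroup (S i)] [∀ i, Module Λ (S i)] (hS : ∀ i, IsSimpleModule Λ (S i))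
    (hall : ∀ (T : Type u) [AddCommGroup T] [Module Λ T], IsSimpleModule Λ T →
        ∃ i, Nonempty (T ≃ₗ[Λ] S i)) (i₀ : ι) {G : Type*} [AddCommGroup G] [Module ℚ G]
    (τ : AddInvariant Λ G) :
    ∃ w : ι → G, w i₀ = 0 ∧ ∀ (T : Type u) [AddCommGroup T] [Module Λ T], IsGood Λ (S i₀) T →
      cls τ T ∈ Submodule.span ℚ (Set.range w) := by
  classical
  let good : ι → ModuleCat.{u} Λ → Prop := fun i E => IsGood Λ (S i₀) E ∧ ∃ f : S i →ₗ[Λ] E, f ≠ 0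
  have hmin : ∀ i, ∃ E : ModuleCat.{u} Λ, (∃ E', good i E') →
      good i E ∧ ∀ E', good i E' → Module.length Λ E ≤ Module.length Λ E' := by
    intro i
    by_cases h : ∃ E', good i E'
    · have hne : {E | good i E}.Nonempty := h
      refine ⟨Function.argminOn (fun E : ModuleCat.{u} Λ => Module.length Λ E) _ hne, fun _ =>
        ⟨Function.argminOn_mem _ _ hne, fun E' hE' => ?_⟩⟩
      exact Function.argminOn_le (fun E : ModuleCat.{u} Λ => Module.length Λ E) _ hE' 
    · exact ⟨.of Λ Λ, fun h' => (h h').elim⟩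
  choose E hE using hmin
  refine ⟨fun i => if ∃ E', good i E' then cls τ (E i) else 0, if_neg ?_, ?_⟩
  · rintro ⟨E', h, f, hf⟩
    exact hf (h.2.2 f)
  have key : ∀ (l : ℕ∞) (T : Type u) [AddCommGroup T] [Module Λ T], Module.length Λ T = l →
      IsGood Λ (S i₀) T → cls τ T ∈ Submodule.span ℚ
        (Set.range fun i => if ∃ E', good i E' then cls τ (E i) else 0) := by
    intro l
    induction l using WellFoundedLT.induction with
    | ind l ih =>
      rintro T _ _ rfl hT
      have := hT.1.1
      rcases subsingleton_or_nontrivial T with hs | hs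
      · have h0 := cls_add (τ := τ) (A := T) (B := T) (C := T) (f := LinearMap.id) (g := 0)
          ⟨fun _ _ h => h, fun x => by simpa using Subsingleton.elim _ _,
            fun x => ⟨0, Subsingleton.elim _ _⟩⟩ hT.1 hT.1 hT.1
        rw [left_eq_add] at h0
        rw [h0]
        exact zero_mem _
      · obtain ⟨N, hN⟩ := exists_simple_submodule_of_nontrivial (Λ := Λ) (M := T)
        obtain ⟨i, ⟨e⟩⟩ := hall N hN
        have := hS i
        have hNt := IsSimpleModule.nontrivial Λ (S i)
        have hu : N.subtype ∘ₗ e.symm.toLinearMap ≠ 0 := by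
          obtain ⟨s, hs⟩ := exists_ne (0 : S i)
          intro h0
          exact hs (by simpa using LinearMap.congr_fun h0 s)
        have hex : ∃ E', good i E' := ⟨.of Λ T, hT, _, hu⟩
        obtain ⟨⟨hEi, v, hv⟩, hm⟩ := hE i hex
        obtain ⟨a, r, har⟩ := hEi.isRetract_of_minimal hT hv hu
          fun E' _ _ h1 h2 => hm (.of Λ E') ⟨h1, h2⟩
        have ha : Function.Injective a :=
          Function.LeftInverse.injective (g := r) (LinearMap.congr_fun har)
        have hses := IsSES.coker ha
        have hgood := (hses.isRetract_right har).isGood hT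
        have hne : LinearMap.range a ≠ ⊥ := by
          intro hbot
          rw [LinearMap.range_eq_bot] at hbot
          apply hv
          rw [← LinearMap.id_comp v, ← har, hbot, LinearMap.comp_zero, LinearMap.zero_comp]
        rw [cls_add hses hEi.1 hT.1 hgood.1]
        refine add_mem (Submodule.subset_span ⟨i, if_pos hex⟩)
          (ih _ (Submodule.length_quotient_lt _ hne) _ rfl hgood)
  exact fun T _ _ hT => key _ T rfl hT

end Good

end Counting

section Coresolved

variable {Λ : Type u} [Ring Λ] {A J M N S₀ : Type u} [AddCommGroup A] [Module Λ A]
  [AddCommGroup J] [Module Λ J] [AddCommGroup M] [Module Λ M] [AddCommGroup N] [Module Λ N]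
  [AddCommGroup S₀] [Module Λ S₀]

/-- `M` has a finite injective coresolution of length `t` by modules without nonzero maps from `S₀`
in which all but possibly the last one have finite projective dimension. -/
def IsCoresolved (S₀ : Type u) [AddCommGroup S₀] [Module Λ S₀] : ℕ → ModuleCat.{u} Λ → Prop
  | 0, M => Module.Finite Λ M ∧ Module.Injective Λ M ∧ ∀ f : S₀ →ₗ[Λ] M, f = 0
  | t + 1, M => ∃ (J K : ModuleCat.{u} Λ) (f : M →ₗ[Λ] J) (g : J →ₗ[Λ] K),
      IsGood Λ S₀ J ∧ IsSES f g ∧ IsCoresolved S₀ t K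

lemma IsCoresolved.prod_isGood {t : ℕ} (hM : IsCoresolved S₀ t (.of Λ M)) (hJ : IsGood Λ S₀ J) :
    IsCoresolved S₀ t (.of Λ (M × J)) := by
  cases t with
  | zero =>
    obtain ⟨h₁, h₂, h₃⟩ := hM
    have : Module.Finite Λ M := h₁
    have := hJ.1.1
    refine ⟨?_, injective_prod h₂ hJ.2.1, hom_prod_eq_zero h₃ hJ.2.2⟩
    change Module.Finite Λ (M × J)
    infer_instance
  | succ t =>
    obtain ⟨J', K, f, g, hJ', h, hK⟩ := hM
    have hid : IsSES (LinearMap.id : J →ₗ[Λ] J) (0 : J →ₗ[Λ] PUnit.{u + 1}) :=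
      ⟨fun _ _ h => h, fun x => by simp, fun x => ⟨0, rfl⟩⟩
    let e : (K × PUnit.{u + 1}) ≃ₗ[Λ] K := LinearEquiv.prodUnique
    exact ⟨.of Λ (J' × J), K, _, _, hJ'.prod hJ, (h.prodMap hid).comp_equiv e, hK⟩

lemma IsCoresolved.prod {t : ℕ} (hM : IsCoresolved S₀ t (.of Λ M))
    (hN : IsCoresolved S₀ t (.of Λ N)) : IsCoresolved S₀ t (.of Λ (M × N)) := by
  induction t generalizing M N with
  | zero =>
    obtain ⟨h₁, h₂, h₃⟩ := hM
    obtain ⟨h₁', h₂', h₃'⟩ := hN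
    have : Module.Finite Λ M := h₁
    have : Module.Finite Λ N := h₁'
    refine ⟨?_, injective_prod h₂ h₂', hom_prod_eq_zero h₃ h₃'⟩
    change Module.Finite Λ (M × N)
    infer_instance
  | succ t ih =>
    obtain ⟨J, K, f, g, hJ, h, hK⟩ := hM
    obtain ⟨J', K', f', g', hJ', h', hK'⟩ := hN
    exact ⟨.of Λ (J × J'), .of Λ (K × K'), _, _, hJ.prod hJ', h.prodMap h', ih hK hK'⟩

lemma IsRetract.isCoresolved {t : ℕ} (hr : IsRetract Λ M N) (hN : IsCoresolved S₀ t (.of Λ N)) :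
    IsCoresolved S₀ t (.of Λ M) := by
  induction t generalizing M N with
  | zero =>
    obtain ⟨h₁, h₂, h₃⟩ := hN
    have : Module.Finite Λ N := h₁
    exact ⟨hr.finite, hr.injective h₂, hr.hom_eq_zero h₃⟩
  | succ t ih =>
    obtain ⟨J, K, f, g, hJ, h, hK⟩ := hN
    have hr' := hr
    obtain ⟨i, p, hip⟩ := hr
    have hpi : ∀ m, p (i m) = m := LinearMap.congr_fun hip
    have hgf : ∀ n, g (f n) = 0 := fun n => (h.exact _).2 ⟨n, rfl⟩
    obtain ⟨e, he⟩ := hJ.2.1.out f h.inj (f ∘ₗ i ∘ₗ p)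
    have hi : Function.Injective (f ∘ₗ i) :=
      h.inj.comp (Function.LeftInverse.injective hpi)
    have hses := IsSES.coker hi
    set π := (LinearMap.range (f ∘ₗ i)).mkQ
    have hπ : ∀ m, π (f (i m)) = 0 := fun m => (hses.exact _).2 ⟨m, rfl⟩
    refine ⟨J, .of Λ (J ⧸ LinearMap.range (f ∘ₗ i)), f ∘ₗ i, π, hJ, hses, ?_⟩
    obtain ⟨α, hα⟩ := hses.desc (g.prod (LinearMap.id - e)) (by
      ext m <;> simp [hgf, he, hpi])
    obtain ⟨β, hβ⟩ := h.desc (π ∘ₗ e) (by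
      ext n
      simp [he, hπ])
    refine ih (N := K × J) ⟨α, β.coprod π, ?_⟩ (IsCoresolved.prod_isGood (M := K) hK hJ)
    refine LinearMap.ext fun c => ?_
    obtain ⟨x, rfl⟩ := hses.surj c
    simp [hα, hβ]

lemma IsCoresolved.pi {t : ℕ} (hM : IsCoresolved S₀ t (.of Λ M)) (k : ℕ) :
    IsCoresolved S₀ t (.of Λ (Fin k → M)) := by
  induction k with
  | zero => exact IsRetract.isCoresolved (N := M) ⟨0, 0, Subsingleton.elim _ _⟩ hM
  | succ k ih =>
    exact (Fin.consLinearEquiv Λ fun _ => M).symm.isRetract.isCoresolved (hM.prod ih)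

lemma IsCoresolved.cls_mem {t : ℕ} {G : Type*} [AddCommGroup G] [Module ℚ G]
    [IsNoetherianRing Λ] {τ : AddInvariant Λ G} {W : Submodule ℚ G}
    (hW : ∀ (T : Type u) [AddCommGroup T] [Module Λ T], IsGood Λ S₀ T → cls τ T ∈ W)
    (h : IsCoresolved S₀ t (.of Λ M)) (hM : FinPd Λ M) : cls τ M ∈ W := by
  induction t generalizing M with
  | zero => exact hW M ⟨hM, h.2⟩
  | succ t ih =>
    obtain ⟨J, K, f, g, hJ, h, hK⟩ := h
    have hK' := h.finPd_right hM hJ.1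
    rw [eq_sub_of_add_eq (cls_add (τ := τ) h hM hJ.1 hK').symm]
    exact sub_mem (hW J hJ) (ih (M := K) hK hK')

/-- The counting argument: the injective modules appearing in a coresolution of `Λ` contain every
simple module in their socle. -/
theorem not_isCoresolved (R : Type u) [CommRing R] [IsArtinianRing R] [Algebra R Λ]
    [Module.Finite R Λ] (S₀ : Type u) [AddCommGroup S₀] [Module Λ S₀] [IsSimpleModule Λ S₀]
    (t : ℕ) :
    ¬ IsCoresolved S₀ t (.of Λ Λ) := by
  classical
  intro h
  have : IsArtinianRing Λ := IsArtinianRing.of_finite R Λ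
  obtain ⟨ι, _, S, hS, hinj, hall⟩ := exists_simples Λ
  obtain ⟨i₀, ⟨e₀⟩⟩ := hall S₀ ‹_›
  have : ∀ i, Module.Finite R (S i) := fun i =>
    Module.Finite.of_injective ((S i).subtype.restrictScalars R) Subtype.val_injective
  let τ : AddInvariant Λ (ι → ℚ) := homInvariant R fun i => S i
  obtain ⟨w, hw0, hw⟩ := exists_span_isGood Λ (fun i => S i) hS hall i₀ τ
  have hgood : ∀ (T : Type u) [AddCommGroup T] [Module Λ T], IsGood Λ S₀ T →
      IsGood Λ (S i₀) T := fun T _ _ hT => ⟨hT.1, hT.2.1, fun f => by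
    ext x
    obtain ⟨y, rfl⟩ := e₀.surjective x
    exact LinearMap.congr_fun (hT.2.2 (f ∘ₗ e₀.toLinearMap)) y⟩
  have hmem : ∀ j, Pi.single j 1 ∈ Submodule.span ℚ (Set.range w) := by
    intro j
    have := hS j
    obtain ⟨P, hPf, hPp, ⟨f, hf⟩, hP⟩ := exists_projective_of_simple (Λ := Λ) (S j)
    obtain ⟨k, q, hq⟩ := Module.Finite.exists_fin' Λ P
    obtain ⟨s, hs⟩ := Module.projective_lifting_property q LinearMap.id hq
    have hPc := IsRetract.isCoresolved (M := P) ⟨s, q, hs⟩ (h.pi k)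
    have hcls := hPc.cls_mem (τ := τ) (fun T _ _ hT => hw T (hgood T hT)) .of_projective
    rw [cls_projective] at hcls
    have hval : τ.val (.of Λ P) = (τ.val (.of Λ P) j) • Pi.single j 1 := by
      funext l
      rcases eq_or_ne l j with rfl | hl
      · simp
      · rw [homInvariant_eq_zero]
        · simp [hl]
        · intro g
          by_contra hg
          exact hl (hinj _ _ (hP _ (hS l) ⟨g, hg⟩))
    rw [hval] at hcls
    exact (Submodule.smul_mem_iff _ (homInvariant_ne_zero hf)).1 hcls
  have htop : ⊤ ≤ Submodule.span ℚ (Set.range w) := by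
    intro v _
    rw [pi_eq_sum_univ' v]
    refine sum_mem fun j _ => Submodule.smul_mem _ _ ?_
    convert hmem j using 2
  have hli := linearIndependent_of_top_le_span_of_card_eq_finrank htop (by simp)
  exact hli.ne_zero i₀ hw0

end Coresolved

section Ext

variable {Λ : Type u} [Ring Λ] {A B C M N U : Type u} [AddCommGroup A] [Module Λ A]
  [AddCommGroup B] [Module Λ B] [AddCommGroup C] [Module Λ C] [AddCommGroup M] [Module Λ M]
  [AddCommGroup N] [Module Λ N] [AddCommGroup U] [Module Λ U]

lemma extVanishes_iff {i : ℕ} : ExtVanishes Λ M N i ↔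
    ∀ x : Abelian.Ext (ModuleCat.of Λ M) (ModuleCat.of Λ N) i, x = 0 :=
  ⟨fun h _ => h.elim _ _, fun h => ⟨fun x y => (h x).trans (h y).symm⟩⟩

lemma extVanishes_zero_iff : ExtVanishes Λ M N 0 ↔ ∀ f : M →ₗ[Λ] N, f = 0 := by
  rw [extVanishes_iff]
  constructor
  · intro h f
    have := (Abelian.Ext.mk₀_eq_zero_iff (ModuleCat.ofHom f)).1 (h _)
    exact congrArg ModuleCat.Hom.hom this
  · intro h x
    obtain ⟨f, rfl⟩ := (Abelian.Ext.mk₀_bijective _ _).2 x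
    rw [Abelian.Ext.mk₀_eq_zero_iff]
    exact ModuleCat.hom_ext (h f.hom)

lemma ExtVanishes.of_injective (hN : Module.Injective Λ N) (i : ℕ) :
    ExtVanishes Λ M N (i + 1) := by
  have := (Module.injective_iff_injective_object Λ N).1 hN
  exact extVanishes_iff.2 fun x => x.eq_zero_of_injective

lemma ExtVanishes.of_projective [Module.Projective Λ M] (i : ℕ) :
    ExtVanishes Λ M N (i + 1) := by
  have := (IsProjective.iff_projective (R := Λ) M).1 ‹_›
  exact extVanishes_iff.2 fun x => x.eq_zero_of_projective

variable (Λ N) in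
/-- Injective dimension of an unbundled module, as in `HasInjectiveDimensionLT`. -/
abbrev IdLT (n : ℕ) : Prop := HasInjectiveDimensionLT (ModuleCat.of Λ N) n

lemma idLT_one_iff : IdLT Λ N 1 ↔ Module.Injective Λ N := by
  rw [IdLT, ← injective_iff_hasInjectiveDimensionLT_one, ← Module.injective_iff_injective_object]

lemma ExtVanishes.of_idLT {n i : ℕ} (h : IdLT Λ N n) (hi : n ≤ i) : ExtVanishes Λ M N i :=
  extVanishes_iff.2 fun x => x.eq_zero_of_hasInjectiveDimensionLT n hi

lemma IsRetract.extVanishes (h : IsRetract Λ A B) {i : ℕ} (hB : ExtVanishes Λ U B i) :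
    ExtVanishes Λ U A i := by
  obtain ⟨s, p, hsp⟩ := h
  rw [extVanishes_iff] at hB ⊢
  intro x
  have hid : ModuleCat.ofHom s ≫ ModuleCat.ofHom p = 𝟙 (ModuleCat.of Λ A) :=
    ModuleCat.hom_ext hsp
  rw [← x.comp_mk₀_id, ← hid, ← Abelian.Ext.mk₀_comp_mk₀,
    ← Abelian.Ext.comp_assoc_of_third_deg_zero,
    hB (x.comp (Abelian.Ext.mk₀ (ModuleCat.ofHom s)) (add_zero i)), Abelian.Ext.zero_comp]

namespace IsSES

variable {f : A →ₗ[Λ] B} {g : B →ₗ[Λ] C}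

lemma extVanishes_snd (h : IsSES f g) {i : ℕ}
    (hA : ExtVanishes Λ U A i) (hC : ExtVanishes Λ U C i) :
    ExtVanishes Λ U B i := by
  rw [extVanishes_iff] at *
  intro x
  obtain ⟨y, rfl⟩ := Abelian.Ext.covariant_sequence_exact₂ _ h.shortExact x (hC _)
  rw [hA y, Abelian.Ext.zero_comp]

lemma extVanishes_right (h : IsSES f g) {i : ℕ}
    (hB : ExtVanishes Λ U B i) (hA : ExtVanishes Λ U A (i + 1)) :
    ExtVanishes Λ U C i := by
  rw [extVanishes_iff] at *
  intro x
  obtain ⟨y, rfl⟩ := Abelian.Ext.covariant_sequence_exact₃ _ h.shortExact x rfl (hA _)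
  rw [hB y, Abelian.Ext.zero_comp]

lemma extVanishes_of_left (h : IsSES f g) {i : ℕ}
    (hB : ExtVanishes Λ B N i) (hC : ExtVanishes Λ C N (i + 1)) :
    ExtVanishes Λ A N i := by
  rw [extVanishes_iff] at *
  intro x
  obtain ⟨y, rfl⟩ := Abelian.Ext.contravariant_sequence_exact₁ h.shortExact _ x (add_comm 1 i)
    (hC _)
  rw [hB y, Abelian.Ext.comp_zero]

lemma extVanishes_of_right (h : IsSES f g) {i : ℕ}
    (hA : ExtVanishes Λ A N i) (hB : ExtVanishes Λ B N (i + 1)) :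
    ExtVanishes Λ C N (i + 1) := by
  rw [extVanishes_iff] at *
  intro x
  obtain ⟨y, rfl⟩ := Abelian.Ext.contravariant_sequence_exact₃ h.shortExact _ x (hB _)
    (add_comm 1 i)
  rw [hA y, Abelian.Ext.comp_zero]

/-- `Ext¹` of the cokernel of a map along which all maps extend. -/
lemma extVanishes_one_of_extend (h : IsSES f g)
    (hext : ∀ φ : A →ₗ[Λ] N, ∃ ψ : B →ₗ[Λ] N, ψ ∘ₗ f = φ)
    (hB : ExtVanishes Λ B N 1) : ExtVanishes Λ C N 1 := by
  rw [extVanishes_iff] at *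
  intro x
  obtain ⟨y, rfl⟩ := Abelian.Ext.contravariant_sequence_exact₃ h.shortExact _ x (hB _)
    (add_zero 1)
  obtain ⟨φ, rfl⟩ := (Abelian.Ext.mk₀_bijective _ _).2 y
  obtain ⟨ψ, hψ⟩ := hext φ.hom
  have : φ = h.complex.f ≫ ModuleCat.ofHom ψ := ModuleCat.hom_ext hψ.symm
  rw [this, ← Abelian.Ext.mk₀_comp_mk₀, ← Abelian.Ext.comp_assoc_of_third_deg_zero,
    h.shortExact.extClass_comp, Abelian.Ext.zero_comp]

/-- Maps lift along a surjection whose kernel has vanishing `Ext¹`. -/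
lemma exists_lift (h : IsSES f g) (hA : ExtVanishes Λ U A 1) (φ : U →ₗ[Λ] C) :
    ∃ ψ : U →ₗ[Λ] B, g ∘ₗ ψ = φ := by
  rw [extVanishes_iff] at hA
  obtain ⟨y, hy⟩ := Abelian.Ext.covariant_sequence_exact₃ _ h.shortExact
    (Abelian.Ext.mk₀ (ModuleCat.ofHom φ)) rfl (hA _)
  obtain ⟨ψ, rfl⟩ := (Abelian.Ext.mk₀_bijective _ _).2 y
  rw [Abelian.Ext.mk₀_comp_mk₀] at hy
  exact ⟨ψ.hom, congrArg ModuleCat.Hom.hom ((Abelian.Ext.mk₀_bijective _ _).1 hy)⟩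

end IsSES

lemma ExtVanishes.pi {i : ℕ} (hN : ExtVanishes Λ U N i) (k : ℕ) :
    ExtVanishes Λ U (Fin k → N) i := by
  induction k with
  | zero => exact IsRetract.extVanishes (B := N) ⟨0, 0, Subsingleton.elim _ _⟩ hN
  | succ k ih =>
    exact (Fin.consLinearEquiv Λ fun _ => N).symm.isRetract.extVanishes
      ((IsSES.inl_snd Λ N (Fin k → N)).extVanishes_snd hN ih)

lemma ExtVanishes.of_finite_projective {i : ℕ} (hU : ExtVanishes Λ U Λ i) [Module.Finite Λ N]
    [Module.Projective Λ N] : ExtVanishes Λ U N i := by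
  obtain ⟨k, q, hq⟩ := Module.Finite.exists_fin' Λ N
  obtain ⟨s, hs⟩ := Module.projective_lifting_property q LinearMap.id hq
  exact IsRetract.extVanishes ⟨s, q, hs⟩ (hU.pi k)

lemma idLT_of_injDimLE {m : ℕ} (h : InjDimLE Λ N m) : IdLT Λ N (m + 1) := by
  induction m generalizing N with
  | zero =>
    obtain ⟨J, g, f, hJ, hs, hg, hgf, hff⟩ := h
    have := hs 1 one_pos
    have e := LinearEquiv.ofBijective g ⟨hg, fun x => (hgf x).1 (Subsingleton.elim _ _)⟩
    exact idLT_one_iff.2 (e.isRetract.injective (hJ 0))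
  | succ m ih =>
    obtain ⟨J, g, f, hJ, hs, hg, hgf, hff⟩ := h
    have hses := IsSES.coker hg
    have hle : LinearMap.range g ≤ LinearMap.ker (f 0) := (LinearMap.exact_iff.1 hgf).ge
    have hK : InjDimLE Λ (J 0 ⧸ LinearMap.range g) m := by
      refine ⟨fun i => J (i + 1), (LinearMap.range g).liftQ (f 0) hle, fun i => f (i + 1),
        fun i => hJ _, fun i hi => hs _ (by omega), ?_, ?_, fun i => hff _⟩
      · rw [← LinearMap.ker_eq_bot]
        exact Submodule.ker_liftQ_eq_bot _ _ _ (LinearMap.exact_iff.1 hgf).le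
      · rw [LinearMap.exact_iff, Submodule.range_liftQ]
        exact LinearMap.exact_iff.1 (hff 0)
    have := idLT_one_iff.2 (hJ 0)
    exact hses.shortExact.hasInjectiveDimensionLT_X₁ (m + 1) (ih hK)
      (hasInjectiveDimensionLT_of_ge (ModuleCat.of Λ (J 0)) 1 (m + 1 + 1) (by omega))

lemma pdLT_two_of_projDimLE (h : ProjDimLE Λ N 1) : PdLT Λ N 2 := by
  obtain ⟨P, f, g, hP, hs, hg, hfg, hff⟩ := h
  have := hs 2 one_lt_two
  have hses : IsSES (f 0) g := by
    refine ⟨?_, hfg, hg⟩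
    rw [injective_iff_map_eq_zero]
    intro x hx
    obtain ⟨y, rfl⟩ := (hff 0 x).1 hx
    rw [Subsingleton.elim y 0, map_zero]
  exact hses.shortExact.hasProjectiveDimensionLT_X₃ 1 (pdLT_one_iff.2 (hP 1))
    (pdLT_mono one_le_two (pdLT_one_iff.2 (hP 0)))

end Ext

section Dominant

variable {Λ : Type u} [Ring Λ] {A B C I J M N S U Y : Type u} [AddCommGroup A] [Module Λ A]
  [AddCommGroup B] [Module Λ B] [AddCommGroup C] [Module Λ C] [AddCommGroup I] [Module Λ I]
  [AddCommGroup J] [Module Λ J] [AddCommGroup M] [Module Λ M] [AddCommGroup N] [Module Λ N]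
  [AddCommGroup S] [Module Λ S] [AddCommGroup U] [Module Λ U] [AddCommGroup Y] [Module Λ Y]

lemma InAdd.exists_isRetract (h : InAdd Λ I J) : ∃ k : ℕ, IsRetract Λ J (Fin k → I) := h

lemma InAdd.finite [Module.Finite Λ I] (h : InAdd Λ I J) : Module.Finite Λ J := by
  obtain ⟨k, hk⟩ := h.exists_isRetract
  exact hk.finite

lemma InAdd.injective (hI : Module.Injective Λ I) (h : InAdd Λ I J) : Module.Injective Λ J := by
  obtain ⟨k, hk⟩ := h.exists_isRetract
  exact hk.injective inferInstance

lemma pdLT_pi {n : ℕ} (h : PdLT Λ N n) (k : ℕ) : PdLT Λ (Fin k → N) n := by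
  induction k with
  | zero => exact IsRetract.pdLT (B := N) ⟨0, 0, Subsingleton.elim _ _⟩ h
  | succ k ih => exact (Fin.consLinearEquiv Λ fun _ => N).symm.isRetract.pdLT (pdLT_prod h ih)

lemma InAdd.pdLT {n : ℕ} (hI : PdLT Λ I n) (h : InAdd Λ I J) : PdLT Λ J n := by
  obtain ⟨k, hk⟩ := h.exists_isRetract
  exact hk.pdLT (pdLT_pi hI k)

lemma InAdd.hom_eq_zero (hI : ∀ f : S →ₗ[Λ] I, f = 0) (h : InAdd Λ I J) (f : S →ₗ[Λ] J) :
    f = 0 := by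
  obtain ⟨k, hk⟩ := h.exists_isRetract
  refine hk.hom_eq_zero (fun f => ?_) f
  ext x i
  exact LinearMap.congr_fun (hI (.proj i ∘ₗ f)) x

lemma InAdd.of_subsingleton [Subsingleton J] : InAdd Λ I J :=
  ⟨0, 0, 0, Subsingleton.elim _ _⟩

lemma InAdd.prod (hM : InAdd Λ I M) (hN : InAdd Λ I N) : InAdd Λ I (M × N) := by
  obtain ⟨k, i, p, hip⟩ := hM
  obtain ⟨l, j, q, hjq⟩ := hN
  let e : (Fin (k + l) → I) ≃ₗ[Λ] (Fin k → I) × (Fin l → I) :=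
    (LinearEquiv.funCongrLeft Λ I finSumFinEquiv).trans
      (LinearEquiv.sumArrowLequivProdArrow (Fin k) (Fin l) Λ I)
  refine ⟨k + l, e.symm.toLinearMap ∘ₗ i.prodMap j, p.prodMap q ∘ₗ e.toLinearMap, ?_⟩
  refine LinearMap.ext fun x => Prod.ext ?_ ?_
  · simpa using LinearMap.congr_fun hip x.1
  · simpa using LinearMap.congr_fun hjq x.2

/-- The `I`-dominant dimension of a module is at least `t`, defined recursively. -/
def HasDomdim (I : Type u) [AddCommGroup I] [Module Λ I] : ℕ → ModuleCat.{u} Λ → Prop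
  | 0, _ => True
  | t + 1, Y => ∃ (J K : ModuleCat.{u} Λ) (f : Y →ₗ[Λ] J) (g : J →ₗ[Λ] K),
      InAdd Λ I J ∧ IsSES f g ∧ HasDomdim I t K

lemma IDomdimGE.hasDomdim {t : ℕ} (h : IDomdimGE Λ I Y t) : HasDomdim I t (.of Λ Y) := by
  induction t generalizing Y with
  | zero => trivial
  | succ t ih =>
    obtain ⟨J, g, f, hJ, hg, hgf, hff⟩ := h
    refine ⟨J 0, .of Λ (J 0 ⧸ LinearMap.range g), g, (LinearMap.range g).mkQ, hJ 0 (by omega),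
      .coker (hg (by omega)), ?_⟩
    cases t with
    | zero => trivial
    | succ t =>
      have hgf := hgf (by omega)
      have hle : LinearMap.range g ≤ LinearMap.ker (f 0) := (LinearMap.exact_iff.1 hgf).ge
      refine ih ⟨fun i => J (i + 1), (LinearMap.range g).liftQ (f 0) hle, fun i => f (i + 1),
        fun i hi => hJ _ (by omega), fun _ => ?_, fun _ => ?_, fun i hi => hff _ (by omega)⟩
      · rw [← LinearMap.ker_eq_bot]
        exact Submodule.ker_liftQ_eq_bot _ _ _ (LinearMap.exact_iff.1 hgf).le
      · rw [LinearMap.exact_iff, Submodule.range_liftQ]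
        exact LinearMap.exact_iff.1 (hff 0 (by omega))

lemma HasDomdim.iDomdimGE {t : ℕ} (h : HasDomdim I t (.of Λ Y)) : IDomdimGE Λ I Y t := by
  induction t generalizing Y with
  | zero => exact ⟨fun _ => .of Λ Y, 0, fun _ => 0, by omega, by omega, by omega, by omega⟩
  | succ t ih =>
    obtain ⟨J, K, p, q, hJ, hpq, hK⟩ := h
    obtain ⟨J', g, f, hJ', hg, hgf, hff⟩ := ih hK
    let J'' : ℕ → ModuleCat.{u} Λ
      | 0 => J
      | i + 1 => J' i
    let f'' : (i : ℕ) → (J'' i : Type u) →ₗ[Λ] (J'' (i + 1) : Type u)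
      | 0 => g ∘ₗ q
      | i + 1 => f i
    refine ⟨J'', p, f'', ?_, fun _ => hpq.inj, fun ht x => ?_, ?_⟩
    · rintro (_ | i) hi
      · exact hJ
      · exact hJ' i (by omega)
    · refine (Iff.trans ?_ (hpq.exact x) :)
      exact map_eq_zero_iff g (hg (by omega))
    · rintro (_ | i) hi x
      · refine (hgf (by omega) x).trans ?_
        exact ⟨fun ⟨y, hy⟩ => by
          obtain ⟨z, rfl⟩ := hpq.surj y
          exact ⟨z, hy⟩, fun ⟨z, hz⟩ => ⟨q z, hz⟩⟩
      · exact hff i (by omega) x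

lemma HasDomdim.of_succ {t : ℕ} {Y : ModuleCat.{u} Λ} (h : HasDomdim I (t + 1) Y) :
    HasDomdim I t Y := by
  induction t generalizing Y with
  | zero => trivial
  | succ t ih =>
    obtain ⟨J, K, f, g, hJ, hfg, hK⟩ := h
    exact ⟨J, K, f, g, hJ, hfg, ih hK⟩

lemma HasDomdim.of_subsingleton [Subsingleton Y] (t : ℕ) : HasDomdim I t (.of Λ Y) := by
  induction t with
  | zero => trivial
  | succ t ih =>
    exact ⟨.of Λ Y, .of Λ Y, 0, 0, .of_subsingleton, ⟨fun _ _ _ => Subsingleton.elim _ _,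
      fun _ => ⟨fun _ => ⟨0, Subsingleton.elim _ _⟩, fun _ => Subsingleton.elim _ _⟩,
      fun _ => ⟨0, Subsingleton.elim _ _⟩⟩, ih⟩

/-- The horseshoe lemma for dominant dimension. -/
lemma IsSES.hasDomdim {f : A →ₗ[Λ] B} {g : B →ₗ[Λ] C} (h : IsSES f g)
    (hI : Module.Injective Λ I) {t : ℕ} (hA : HasDomdim I t (.of Λ A))
    (hC : HasDomdim I t (.of Λ C)) : HasDomdim I t (.of Λ B) := by
  induction t generalizing A B C with
  | zero => trivial
  | succ t ih =>
    obtain ⟨J, K, j, p, hJ, hjp, hK⟩ := hA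
    obtain ⟨J', K', j', p', hJ', hjp', hK'⟩ := hC
    obtain ⟨b, hb⟩ := (hJ.injective hI).out f h.inj j
    let φ : B →ₗ[Λ] J × J' := b.prod (j' ∘ₗ g)
    have hφ : Function.Injective φ := by
      rw [injective_iff_map_eq_zero]
      intro x hx
      obtain ⟨h₁, h₂⟩ := Prod.mk.inj hx
      obtain ⟨a, rfl⟩ := (h.exact x).1 ((map_eq_zero_iff j' hjp'.inj).1 h₂)
      have : j a = 0 := (hb a).symm.trans h₁
      rw [(map_eq_zero_iff j hjp.inj).1 this, map_zero]
    have hQ := IsSES.coker hφ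
    set π := (LinearMap.range φ).mkQ with hπ
    obtain ⟨α, hα⟩ := hjp.desc (π ∘ₗ .inl Λ J J') (by
      ext a
      exact (hQ.exact _).2 ⟨f a, Prod.ext (hb a)
        (by simp [φ, (h.exact (f a)).2 ⟨a, rfl⟩])⟩)
    obtain ⟨β, hβ⟩ := hQ.desc (p' ∘ₗ .snd Λ J J') (by
      ext x
      exact (hjp'.exact _).2 ⟨g x, rfl⟩)
    have hαβ : IsSES α β := by
      refine ⟨?_, ?_, ?_⟩
      · rw [injective_iff_map_eq_zero]
        intro k hk
        obtain ⟨y, rfl⟩ := hjp.surj k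
        rw [hα] at hk
        obtain ⟨x, hx⟩ := (hQ.exact _).1 hk
        obtain ⟨h₁, h₂⟩ := Prod.mk.inj hx
        obtain ⟨a, rfl⟩ := (h.exact x).1 ((map_eq_zero_iff j' hjp'.inj).1 h₂)
        exact (hjp.exact y).2 ⟨a, (hb a).symm.trans h₁⟩
      · intro z
        obtain ⟨⟨y, y'⟩, rfl⟩ := hQ.surj z
        rw [hβ]
        constructor
        · intro hz
          obtain ⟨c, hc⟩ := (hjp'.exact _).1 hz
          obtain ⟨x, rfl⟩ := h.surj c
          refine ⟨p (y - b x), ?_⟩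
          rw [hα, ← sub_eq_zero, LinearMap.comp_apply, ← map_sub]
          refine (hQ.exact _).2 ⟨-x, ?_⟩
          ext
          · simp [φ]
          · simpa [φ] using hc
        · rintro ⟨k, hk⟩
          obtain ⟨w, rfl⟩ := hjp.surj k
          rw [hα] at hk
          rw [← hβ, ← hk, LinearMap.comp_apply, hβ]
          simp
      · intro k
        obtain ⟨y, rfl⟩ := hjp'.surj k
        exact ⟨π (0, y), hβ _⟩
    exact ⟨.of Λ (J × J'), .of Λ _, φ, π, hJ.prod hJ', hQ, ih hαβ hK hK'⟩

lemma IsSES.equiv_mid {f : A →ₗ[Λ] B} {g : B →ₗ[Λ] C} (h : IsSES f g) (e : B ≃ₗ[Λ] M) :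
    IsSES (e.toLinearMap ∘ₗ f) (g ∘ₗ e.symm.toLinearMap) where
  inj := e.injective.comp h.inj
  exact := by
    intro x
    obtain ⟨x, rfl⟩ := e.surjective x
    simp [h.exact x]
  surj := h.surj.comp e.symm.surjective

lemma HasDomdim.pi (hI : Module.Injective Λ I) {t : ℕ} (h : HasDomdim I t (.of Λ Y)) (k : ℕ) :
    HasDomdim I t (.of Λ (Fin k → Y)) := by
  induction k with
  | zero => exact .of_subsingleton t
  | succ k ih =>
    exact ((IsSES.inl_snd Λ Y (Fin k → Y)).equiv_mid
      (Fin.consLinearEquiv Λ fun _ => Y)).hasDomdim hI h ih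

/-- The dominant dimension of a submodule of `B` with cokernel `C`. -/
lemma IsSES.hasDomdim_left {J K : Type u} [AddCommGroup J] [Module Λ J] [AddCommGroup K]
    [Module Λ K] (hI : Module.Injective Λ I) {t : ℕ} {f : A →ₗ[Λ] B} {g : B →ₗ[Λ] C}
    (h : IsSES f g) (hC : HasDomdim I t (.of Λ C))
    (hJ : InAdd Λ I J) {j : B →ₗ[Λ] J} {p : J →ₗ[Λ] K} (hjp : IsSES j p)
    (hK : HasDomdim I t (.of Λ K)) : HasDomdim I (t + 1) (.of Λ A) := by
  have hQ := IsSES.coker (f := j ∘ₗ f) (hjp.inj.comp h.inj)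
  set π := (LinearMap.range (j ∘ₗ f)).mkQ with hπ
  obtain ⟨α, hα⟩ := h.desc (π ∘ₗ j) (by
    ext a
    exact (hQ.exact _).2 ⟨a, rfl⟩)
  obtain ⟨β, hβ⟩ := hQ.desc p (by
    ext x
    exact (hjp.exact _).2 ⟨f x, rfl⟩)
  have hαβ : IsSES α β := by
    refine ⟨?_, ?_, ?_⟩
    · rw [injective_iff_map_eq_zero]
      intro c hc
      obtain ⟨b, rfl⟩ := h.surj c
      rw [hα] at hc
      obtain ⟨a, ha⟩ := (hQ.exact _).1 hc
      exact (h.exact b).2 ⟨a, hjp.inj ha⟩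
    · intro z
      obtain ⟨y, rfl⟩ := hQ.surj z
      rw [hβ, hjp.exact]
      constructor
      · rintro ⟨b, rfl⟩
        exact ⟨g b, hα b⟩
      · rintro ⟨c, hc⟩
        obtain ⟨b, rfl⟩ := h.surj c
        rw [hα] at hc
        refine (hjp.exact y).1 ?_
        rw [← hβ, ← hc, LinearMap.comp_apply, hβ]
        exact (hjp.exact _).2 ⟨b, rfl⟩
    · intro k
      obtain ⟨y, rfl⟩ := hjp.surj k
      exact ⟨π y, hβ y⟩
  exact ⟨.of Λ J, .of Λ _, j ∘ₗ f, π, hJ, hQ, hαβ.hasDomdim hI hC hK⟩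

/-- A module with large dominant dimension and small injective dimension has a coresolution without
maps from `S` as soon as the corresponding `Ext` vanishes on a module containing `S`. -/
lemma HasDomdim.isCoresolved [Module.Finite Λ I] (hI : Module.Injective Λ I) {n : ℕ}
    (hpd : PdLT Λ I n) {i : S →ₗ[Λ] U} (hi : Function.Injective i)
    (hUI : ∀ f : U →ₗ[Λ] I, f = 0) {t : ℕ} [hY : Module.Finite Λ Y] (hdom : HasDomdim I t (.of Λ Y))
    (hid : IdLT Λ Y (t + 1)) (hext : ExtVanishes Λ U Y t) : IsCoresolved S t (.of Λ Y) := by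
  have key : ∀ (J : Type u) [AddCommGroup J] [Module Λ J], Module.Injective Λ J →
      (∀ f : U →ₗ[Λ] J, f = 0) → ∀ f : S →ₗ[Λ] J, f = 0 := by
    intro J _ _ hJ h f
    obtain ⟨f', hf'⟩ := hJ.out i hi f
    ext x
    rw [← hf', h f']
    rfl
  induction t generalizing Y with
  | zero =>
    have := idLT_one_iff.1 hid
    exact ⟨hY, this, key Y this (extVanishes_zero_iff.1 hext)⟩
  | succ t ih =>
    obtain ⟨J, K, f, g, hJ, hfg, hK⟩ := hdom
    have hJinj := hJ.injective hI
    have hJfin := hJ.finite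
    have hJhom := hJ.hom_eq_zero hUI
    have := hfg.finite_right
    have := idLT_one_iff.2 hJinj
    refine ⟨J, K, f, g, ⟨⟨hJfin, n, hJ.pdLT hpd⟩, hJinj, key J hJinj hJhom⟩, hfg,
      ih hK (hfg.shortExact.hasInjectiveDimensionLT_X₃ (t + 1)
        (hasInjectiveDimensionLT_of_ge (ModuleCat.of Λ J) 1 (t + 1) (by omega)) hid)
        (hfg.extVanishes_right ?_ hext)⟩
    cases t with
    | zero => exact extVanishes_zero_iff.2 hJhom
    | succ t => exact .of_injective hJinj t

end Dominant

section GorensteinProjective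

variable {Λ : Type u} [Ring Λ] {I X : Type u} [AddCommGroup I] [Module Λ I] [Module.Finite Λ I]
  [AddCommGroup X] [Module Λ X]

/-- A module with `Ext^{n+1}(X, Λ) = 0` is cogenerated by `I`. -/
lemma exists_apply_ne_zero_of_hasDomdim (R : Type u) [CommRing R] [IsArtinianRing R] [Algebra R Λ]
    [Module.Finite R Λ] [Module.Finite Λ X] (hI : Module.Injective Λ I) {d t : ℕ} (hpd : PdLT Λ I d)
    (hid : IdLT Λ Λ (t + 1)) (hdom : HasDomdim I t (.of Λ Λ)) (hX : ExtVanishes Λ X Λ t) {x : X}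
    (hx : x ≠ 0) : ∃ f : X →ₗ[Λ] I, f x ≠ 0 := by
  by_contra! hzero
  have : IsArtinianRing Λ := IsArtinianRing.of_finite R Λ
  let U : Submodule Λ X := ⨅ f : X →ₗ[Λ] I, LinearMap.ker f
  have hmem : ∀ {y : X}, y ∈ U ↔ ∀ f : X →ₗ[Λ] I, f y = 0 := by simp [U]
  have hUI : ∀ f : U →ₗ[Λ] I, f = 0 := by
    intro f
    obtain ⟨f', hf'⟩ := hI.out U.subtype U.injective_subtype f
    ext y
    rw [← hf' y]
    exact hmem.1 y.2 f'
  have : Nontrivial U := ⟨⟨x, hmem.2 hzero⟩, 0, fun h => hx (congrArg Subtype.val h)⟩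
  obtain ⟨S, hS⟩ := exists_simple_submodule_of_nontrivial (Λ := Λ) (M := U)
  have hU : ExtVanishes Λ U Λ t :=
    (IsSES.mkQ U).extVanishes_of_left hX (.of_idLT hid le_rfl)
  exact not_isCoresolved R S t (hdom.isCoresolved hI hpd S.injective_subtype hUI hid hU)

/-- If `I` has projective dimension at most one, then maps to `I` from a module with vanishing first
`Ext` factor through finitely generated free modules. -/
lemma exists_apply_ne_zero_of_pdLT_two [IsNoetherianRing Λ] (hpd : PdLT Λ I 2)
    (hX : ExtVanishes Λ X Λ 1) {x : X} {f : X →ₗ[Λ] I} (hf : f x ≠ 0) :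
    ∃ φ : X →ₗ[Λ] Λ, φ x ≠ 0 := by
  obtain ⟨k, q, hq⟩ := Module.Finite.exists_fin' Λ I
  have hses := IsSES.ker hq
  have : Module.Projective Λ (LinearMap.ker q) := by
    refine pdLT_one_iff.1 (hses.shortExact.hasProjectiveDimensionLT_X₁ 1 ?_ hpd)
    exact pdLT_one_iff.2 inferInstance
  obtain ⟨ψ, rfl⟩ := hses.exists_lift hX.of_finite_projective f
  have : ψ x ≠ 0 := fun h => hf (by simp [h])
  obtain ⟨i, hi⟩ := Function.ne_iff.1 this
  exact ⟨.proj i ∘ₗ ψ, hi⟩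

/-- Finitely generated modules admit left approximations by finitely generated free modules. -/
lemma exists_left_approximation (R : Type u) [CommRing R] [IsArtinianRing R] [Algebra R Λ]
    [Module.Finite R Λ] (X : Type u) [AddCommGroup X] [Module Λ X] [Module.Finite Λ X] :
    ∃ (m : ℕ) (a : X →ₗ[Λ] (Fin m → Λ)),
      ∀ φ : X →ₗ[Λ] Λ, ∃ ψ : (Fin m → Λ) →ₗ[Λ] Λ, ψ ∘ₗ a = φ := by
  have := finite_linearMap R (Λ := Λ) X Λ
  obtain ⟨m, s, hs⟩ := Module.Finite.exists_fin (R := R) (M := X →ₗ[Λ] Λ)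
  refine ⟨m, LinearMap.pi s, fun φ => ?_⟩
  have hφ : φ ∈ Submodule.span R (Set.range s) := hs ▸ Submodule.mem_top
  obtain ⟨c, rfl⟩ := (Submodule.mem_span_range_iff_exists_fun R).1 hφ
  refine ⟨∑ i, c i • LinearMap.proj i, ?_⟩
  ext x
  simp

theorem hasDomdim_of_gorensteinProjective (R : Type u) [CommRing R] [IsArtinianRing R] [Algebra R Λ]
    [Module.Finite R Λ] [Module.Finite Λ X] (hI : Module.Injective Λ I) (hpd : PdLT Λ I 2) {n t : ℕ}
    (hid : IdLT Λ Λ (n + 2)) (hdom : HasDomdim I (n + 1) (.of Λ Λ))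
    (hX : ∀ i, 1 ≤ i → ExtVanishes Λ X Λ i) (ht : HasDomdim I t (.of Λ Λ)) :
    HasDomdim I t (.of Λ X) := by
  have : IsArtinianRing Λ := IsArtinianRing.of_finite R Λ
  induction t generalizing X with
  | zero => trivial
  | succ t ih =>
    obtain ⟨m, a, ha⟩ := exists_left_approximation R (Λ := Λ) X
    have hinj : Function.Injective a := by
      rw [injective_iff_map_eq_zero]
      intro x hx
      by_contra hx0
      obtain ⟨f, hf⟩ := exists_apply_ne_zero_of_hasDomdim R hI hpd hid hdom (hX _ (by omega)) hx0
      obtain ⟨φ, hφ⟩ := exists_apply_ne_zero_of_pdLT_two hpd (hX 1 le_rfl) hf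
      obtain ⟨ψ, rfl⟩ := ha φ
      exact hφ (by simp [hx])
    have hses := IsSES.coker hinj
    have hcoker := ih (X := (Fin m → Λ) ⧸ LinearMap.range a) (fun i hi => by
      obtain ⟨i, rfl⟩ := Nat.exists_eq_add_of_le' hi
      cases i with
      | zero => exact hses.extVanishes_one_of_extend ha (.of_projective 0)
      | succ i => exact hses.extVanishes_of_right (hX _ (by omega)) (.of_projective _)) ht.of_succ
    obtain ⟨J, K, j, p, hJ, hjp, hK⟩ := ht.pi hI m
    exact hses.hasDomdim_left hI hcoker hJ hjp hK

end GorensteinProjective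

/-- Let `Λ` be an almost `n`-minimal Auslander-Gorenstein algebra (`n ≥ 1`):
`I` is the injective module with `add I` = {injectives of projective dimension ≤ 1}, and
`id Λ ≤ n+1 ≤ I`-domdim `Λ`. Then every finitely generated Gorenstein projective `Λ`-module
`X` (i.e. `Ext^i_Λ(X,Λ) = 0` for all `i ≥ 1`) satisfies `I`-domdim `X ≥ n+1`. -/
theorem stmt12 (R : Type u) [CommRing R] [IsArtinianRing R]
    (Λ : Type u) [Ring Λ] [Algebra R Λ] [Module.Finite R Λ]
    (n : ℕ) (hn : 1 ≤ n)
    (I : Type u) [AddCommGroup I] [Module Λ I] [Module.Finite Λ I]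
    (hIinj : Module.Injective Λ I) (hIpd : ProjDimLE Λ I 1)
    (haddI : ∀ (J : Type u) [AddCommGroup J] [Module Λ J], Module.Finite Λ J →
      ((Module.Injective Λ J ∧ ProjDimLE Λ J 1) ↔ InAdd Λ I J))
    (hid : InjDimLE Λ Λ (n + 1))
    (hdom : IDomdimGE Λ I Λ (n + 1))
    (X : Type u) [AddCommGroup X] [Module Λ X] [Module.Finite Λ X]
    (hGP : ∀ i : ℕ, 1 ≤ i → ExtVanishes Λ X Λ i) :
    IDomdimGE Λ I X (n + 1) := by
  have h := hasDomdim_of_gorensteinProjective R hIinj (pdLT_two_of_projDimLE hIpd)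
    (idLT_of_injDimLE hid) hdom.hasDomdim hGP hdom.hasDomdim
  exact h.iDomdimGE
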